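/- Let n ≥ 21 and let s be an integer with 2 ≤ s ≤ 2^(n−1). Set N = (∑_{k=3}^n C(n,k)) + (n−1). A family 𝓐 of subsets of [n] with |𝓐| = N maximises |𝕀^(s)(𝓐)| over all families of subsets of [n] of size N if and only if there is a permutation σ of [n] such that 𝓐 = {σ(A) : A ∈ [n]^(≥3) ∪ {A ∈ [n]^(2) : 1 ∈ A}} (σ applied elementwise to each set). In particular, the maximising family is unique up to reordering the coordinates. -/

import Mathlib

open Finset

/-- The ground set `[n] = {1, …, n}`. -/
def groundSet (n : ℕ) : Finset ℕ := Finset.Icc 1 n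

/-- All subsets of `[n]`. -/
def allFams (n : ℕ) : Finset (Finset ℕ) := (groundSet n).powerset

/-- `[n]^(≥ r)`: subsets of `[n]` of size at least `r`. -/
def layerGE (n r : ℕ) : Finset (Finset ℕ) := (allFams n).filter fun A => r ≤ A.card

/-- `[n]^(r)`: subsets of `[n]` of size exactly `r`. -/
def layerEQ (n r : ℕ) : Finset (Finset ℕ) := (groundSet n).powersetCard r

/-- `𝕀^(s)(𝓐)`: the intersecting subfamilies of `𝓐` of size `s`. -/
def interFams (s : ℕ) (𝓐 : Finset (Finset ℕ)) : Finset (Finset (Finset ℕ)) :=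
  (𝓐.powersetCard s).filter fun 𝓔 => ∀ B ∈ 𝓔, ∀ B' ∈ 𝓔, (B ∩ B').Nonempty


theorem mem_interFams {s : ℕ} {𝓐 𝓔 : Finset (Finset ℕ)} :
    𝓔 ∈ interFams s 𝓐 ↔ 𝓔 ⊆ 𝓐 ∧ 𝓔.card = s ∧ ∀ B ∈ 𝓔, ∀ B' ∈ 𝓔, (B ∩ B').Nonempty := by
  simp [interFams, mem_powersetCard, and_assoc]

/-- An injection that preserves the relation of meeting does not decrease the count. -/
theorem card_interFams_le_of_injOn {s : ℕ} {𝓐 𝓐' : Finset (Finset ℕ)} (θ : Finset ℕ → Finset ℕ)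
    (hmaps : ∀ F ∈ 𝓐, θ F ∈ 𝓐') (hinj : Set.InjOn θ 𝓐)
    (hmeet : ∀ F ∈ 𝓐, ∀ F' ∈ 𝓐, (F ∩ F').Nonempty → (θ F ∩ θ F').Nonempty) :
    (interFams s 𝓐).card ≤ (interFams s 𝓐').card := by
  refine card_le_card_of_injOn (fun 𝓔 => 𝓔.image θ) ?_ ?_
  · intro 𝓔 h𝓔
    obtain ⟨h1, h2, h3⟩ := mem_interFams.1 h𝓔
    refine mem_interFams.2 ⟨?_, ?_, ?_⟩
    · intro F hF
      obtain ⟨G, hG, rfl⟩ := mem_image.1 hF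
      exact hmaps G (h1 hG)
    · rw [card_image_of_injOn (hinj.mono (by exact_mod_cast h1)), h2]
    · intro B hB B' hB'
      obtain ⟨G, hG, rfl⟩ := mem_image.1 hB
      obtain ⟨G', hG', rfl⟩ := mem_image.1 hB'
      exact hmeet G (h1 hG) G' (h1 hG') (h3 G hG G' hG')
  · intro 𝓔 h𝓔 𝓔' h𝓔' heq
    have h1 := (mem_interFams.1 h𝓔).1
    have h1' := (mem_interFams.1 h𝓔').1
    have key : ∀ 𝓕 𝓕' : Finset (Finset ℕ), 𝓕 ⊆ 𝓐 → 𝓕' ⊆ 𝓐 → 𝓕.image θ = 𝓕'.image θ → 𝓕 ⊆ 𝓕' := by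
      intro 𝓕 𝓕' h h' e F hF
      have : θ F ∈ 𝓕'.image θ := e ▸ mem_image_of_mem θ hF
      obtain ⟨G, hG, hGF⟩ := mem_image.1 this
      rwa [← hinj (h' hG) (h hF) hGF]
    exact Subset.antisymm (key _ _ h1 h1' heq) (key _ _ h1' h1 heq.symm)

theorem card_interFams_mono {s : ℕ} {𝓐 𝓐' : Finset (Finset ℕ)} (h : 𝓐 ⊆ 𝓐') :
    (interFams s 𝓐).card ≤ (interFams s 𝓐').card :=
  card_interFams_le_of_injOn id h Function.injective_id.injOn fun _ _ _ _ h => h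

theorem inter_image_perm_nonempty (σ : Equiv.Perm ℕ) {F F' : Finset ℕ}
    (h : (F ∩ F').Nonempty) : (F.image σ ∩ F'.image σ).Nonempty := by
  rw [← image_inter _ _ σ.injective]
  exact h.image σ

theorem card_interFams_image_perm (s : ℕ) (σ : Equiv.Perm ℕ) (𝓐 : Finset (Finset ℕ)) :
    (interFams s (𝓐.image fun A => A.image σ)).card = (interFams s 𝓐).card := by
  have key : ∀ (π : Equiv.Perm ℕ) (𝓑 : Finset (Finset ℕ)),
      (interFams s 𝓑).card ≤ (interFams s (𝓑.image fun A => A.image π)).card := fun π 𝓑 =>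
    card_interFams_le_of_injOn (fun A => A.image π) (fun F hF => mem_image_of_mem _ hF)
      (image_injective π.injective).injOn fun F _ F' _ h => inter_image_perm_nonempty π h
  refine le_antisymm ?_ (key σ 𝓐)
  have h := key σ.symm (𝓐.image fun A => A.image σ)
  rwa [image_image, show ((fun A : Finset ℕ => A.image σ.symm) ∘ fun A => A.image σ) = id by
    funext A; simp [image_image], image_id] at h

/-- Families containing a prescribed set, in terms of the sets meeting it. -/
theorem card_interFams_insert (t : ℕ) {A : Finset ℕ} {𝓒 : Finset (Finset ℕ)} (hA : A ∉ 𝓒)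
    (hne : A.Nonempty) :
    (interFams (t + 1) (insert A 𝓒)).card =
      (interFams (t + 1) 𝓒).card + (interFams t (𝓒.filter fun F => (F ∩ A).Nonempty)).card := by
  rw [← card_filter_add_card_filter_not (s := interFams (t + 1) (insert A 𝓒)) fun 𝓔 => A ∉ 𝓔]
  congr 1
  · congr 1
    ext 𝓔
    simp only [mem_filter, mem_interFams]
    constructor
    · rintro ⟨⟨h1, h2, h3⟩, h4⟩
      exact ⟨(subset_insert_iff_of_notMem h4).1 h1, h2, h3⟩
    · rintro ⟨h1, h2, h3⟩
      exact ⟨⟨h1.trans (subset_insert _ _), h2, h3⟩, fun h => hA (h1 h)⟩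
  · refine card_bij' (fun 𝓔 _ => 𝓔.erase A) (fun 𝓔 _ => insert A 𝓔) ?_ ?_ ?_ ?_
    · intro 𝓔 h
      obtain ⟨h, hA𝓔⟩ := mem_filter.1 h
      rw [not_not] at hA𝓔
      obtain ⟨h1, h2, h3⟩ := mem_interFams.1 h
      refine mem_interFams.2 ⟨?_, ?_, ?_⟩
      · intro F hF
        obtain ⟨hF1, hF2⟩ := mem_erase.1 hF
        exact mem_filter.2 ⟨(mem_insert.1 (h1 hF2)).resolve_left hF1, h3 F hF2 A hA𝓔⟩
      · rw [card_erase_of_mem hA𝓔, h2]; rfl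
      · exact fun B hB B' hB' => h3 B (mem_of_mem_erase hB) B' (mem_of_mem_erase hB')
    · intro 𝓔 h
      obtain ⟨h1, h2, h3⟩ := mem_interFams.1 h
      have hA𝓔 : A ∉ 𝓔 := fun h => hA (mem_filter.1 (h1 h)).1
      refine mem_filter.2 ⟨mem_interFams.2 ⟨?_, ?_, ?_⟩, by simp⟩
      · exact insert_subset_insert _ (h1.trans (filter_subset _ _))
      · rw [card_insert_of_notMem hA𝓔, h2]
      · intro B hB B' hB'
        obtain hBA | hB1 := mem_insert.1 hB <;> obtain hBA' | hB1' := mem_insert.1 hB'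
        · simpa [hBA, hBA'] using hne
        · rw [hBA, inter_comm]; exact (mem_filter.1 (h1 hB1')).2
        · rw [hBA']; exact (mem_filter.1 (h1 hB1)).2
        · exact h3 B hB1 B' hB1'
    · intro 𝓔 h
      exact insert_erase (not_not.1 (mem_filter.1 h).2)
    · intro 𝓔 h
      exact erase_insert fun h' => hA (mem_filter.1 ((mem_interFams.1 h).1 h')).1

/-- Two meeting sets lie in an intersecting family of any size up to half the cube, all of whose
other members are supersets of one of them or have at least half the points. -/
theorem exists_interFam_of_pair {n s : ℕ} (hn : 1 ≤ n) (hs1 : 2 ≤ s) (hs2 : s ≤ 2 ^ (n - 1))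
    {S F : Finset ℕ} (hS : S ⊆ groundSet n) (hF : F ⊆ groundSet n) (hSF : (S ∩ F).Nonempty) :
    ∃ 𝓔 : Finset (Finset ℕ), 𝓔.card = s ∧ S ∈ 𝓔 ∧ F ∈ 𝓔 ∧
      (∀ B ∈ 𝓔, ∀ B' ∈ 𝓔, (B ∩ B').Nonempty) ∧
      ∀ X ∈ 𝓔, X ⊆ groundSet n ∧ (S ⊆ X ∨ F ⊆ X ∨ n ≤ 2 * X.card) := by
  classical
  have hg : (groundSet n).card = n := by simp [groundSet]
  set g := groundSet n with hgdef
  have h1g : 1 ∈ g := by simp [hgdef, groundSet, hn]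
  let up : Finset ℕ → Prop := fun X => S ⊆ X ∨ F ⊆ X
  let maj : Finset ℕ → Prop := fun X => n < 2 * X.card ∨ (2 * X.card = n ∧ 1 ∈ X)
  let 𝓜 := g.powerset.filter fun X => up X ∨ (maj X ∧ ¬ up (g \ X))
  have hup : ∀ X Y, up X → up Y → (X ∩ Y).Nonempty := by
    intro X Y hX hY
    obtain ⟨x, hx⟩ := hSF
    obtain ⟨y, hy⟩ : S.Nonempty := ⟨x, (mem_inter.1 hx).1⟩
    obtain ⟨z, hz⟩ : F.Nonempty := ⟨x, (mem_inter.1 hx).2⟩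
    rw [mem_inter] at hx
    rcases hX with hX | hX <;> rcases hY with hY | hY
    · exact ⟨y, mem_inter.2 ⟨hX hy, hY hy⟩⟩
    · exact ⟨x, mem_inter.2 ⟨hX hx.1, hY hx.2⟩⟩
    · exact ⟨x, mem_inter.2 ⟨hX hx.2, hY hx.1⟩⟩
    · exact ⟨z, mem_inter.2 ⟨hX hz, hY hz⟩⟩
  have hupmono : ∀ X Y : Finset ℕ, X ⊆ Y → up X → up Y := by
    intro X Y h hX
    rcases hX with hX | hX
    · exact Or.inl (hX.trans h)
    · exact Or.inr (hX.trans h)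
  have hmaj : ∀ X Y : Finset ℕ, X ⊆ g → Y ⊆ g → maj X → maj Y → (X ∩ Y).Nonempty := by
    intro X Y hX hY hmX hmY
    by_contra hne
    rw [not_nonempty_iff_eq_empty] at hne
    have hd : Disjoint X Y := disjoint_iff_inter_eq_empty.2 hne
    have hc : X.card + Y.card ≤ n := by
      rw [← card_union_of_disjoint hd, ← hg]
      exact card_le_card (union_subset hX hY)
    rcases hmX with hmX | ⟨hmX, hx⟩ <;> rcases hmY with hmY | ⟨hmY, hy⟩
    · omega
    · omega
    · omega
    · exact absurd (mem_inter.2 ⟨hx, hy⟩) (by simp [hne])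
  have hmix : ∀ X Y : Finset ℕ, X ⊆ g → up X → ¬ up (g \ Y) → (X ∩ Y).Nonempty := by
    intro X Y hX hu hY
    by_contra hne
    rw [not_nonempty_iff_eq_empty, ← disjoint_iff_inter_eq_empty] at hne
    exact hY (hupmono X _ (fun a ha => mem_sdiff.2 ⟨hX ha, disjoint_left.1 hne ha⟩) hu)
  have hmeet : ∀ B ∈ 𝓜, ∀ B' ∈ 𝓜, (B ∩ B').Nonempty := by
    intro B hB B' hB'
    obtain ⟨hBg, hB⟩ := mem_filter.1 hB
    obtain ⟨hBg', hB'⟩ := mem_filter.1 hB'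
    rw [mem_powerset] at hBg hBg'
    rcases hB with hB | ⟨hB, hB2⟩ <;> rcases hB' with hB' | ⟨hB', hB2'⟩
    · exact hup _ _ hB hB'
    · exact hmix _ _ hBg hB hB2'
    · rw [inter_comm]; exact hmix _ _ hBg' hB' hB2
    · exact hmaj _ _ hBg hBg' hB hB'
  have hcard : 2 ^ (n - 1) ≤ 𝓜.card := by
    have hcov : g.powerset ⊆ 𝓜 ∪ 𝓜.image fun X => g \ X := by
      intro X hX
      rw [mem_powerset] at hX
      have hXX : g \ (g \ X) = X := by rw [sdiff_sdiff_right_self]; exact inf_eq_right.2 hX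
      have hc : (g \ X).card + X.card = n := by rw [card_sdiff_add_card_eq_card hX, hg]
      by_cases h1 : X ∈ 𝓜
      · exact mem_union_left _ h1
      refine mem_union_right _ (mem_image.2 ⟨g \ X, ?_, hXX⟩)
      have h1' : ¬ (up X ∨ (maj X ∧ ¬ up (g \ X))) := fun h =>
        h1 (mem_filter.2 ⟨mem_powerset.2 hX, h⟩)
      push Not at h1'
      refine mem_filter.2 ⟨mem_powerset.2 sdiff_subset, ?_⟩
      by_cases hu : up (g \ X)
      · exact Or.inl hu
      right
      rw [hXX]
      refine ⟨?_, h1'.1⟩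
      have hmX : ¬ maj X := fun h => hu (h1'.2 h)
      simp only [maj, not_or, not_and, not_lt] at hmX ⊢
      rcases lt_or_eq_of_le hmX.1 with h | h
      · left; omega
      · right
        exact ⟨by omega, mem_sdiff.2 ⟨h1g, hmX.2 h⟩⟩
    have := card_le_card hcov
    rw [card_powerset, hg] at this
    have h2 := (this.trans (card_union_le _ _)).trans (Nat.add_le_add_left card_image_le _)
    have h3 : 2 ^ n = 2 * 2 ^ (n - 1) := by
      rw [← pow_succ']; congr 1; omega
    omega
  have hSm : S ∈ 𝓜 := mem_filter.2 ⟨mem_powerset.2 hS, Or.inl (Or.inl subset_rfl)⟩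
  have hFm : F ∈ 𝓜 := mem_filter.2 ⟨mem_powerset.2 hF, Or.inl (Or.inr subset_rfl)⟩
  obtain ⟨𝓔, h1, h2, h3⟩ := exists_subsuperset_card_eq (s := {S, F}) (t := 𝓜) (n := s)
    (insert_subset hSm (singleton_subset_iff.2 hFm)) (card_le_two.trans hs1) (hs2.trans hcard)
  refine ⟨𝓔, h3, h1 (by simp), h1 (by simp), fun B hB B' hB' => hmeet B (h2 hB) B' (h2 hB'), ?_⟩
  intro X hX
  obtain ⟨hXg, hX⟩ := mem_filter.1 (h2 hX)
  refine ⟨mem_powerset.1 hXg, ?_⟩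
  rcases hX with (hX | hX) | ⟨hX | hX, -⟩
  · exact Or.inl hX
  · exact Or.inr (Or.inl hX)
  · exact Or.inr (Or.inr hX.le)
  · exact Or.inr (Or.inr hX.1.ge)


/-- `S` with `U` exchanged for `V`. -/
def moveSet (U V S : Finset ℕ) : Finset ℕ := (S \ U) ∪ V

/-- The sets on which exchanging `U` for `V` makes sense. -/
def Exchangeable (U V S : Finset ℕ) : Prop := U ⊆ S ∧ Disjoint V S

/-- Members of `𝓐` that the compression replaces. -/
def Movable (U V : Finset ℕ) (𝓐 : Finset (Finset ℕ)) (S : Finset ℕ) : Prop :=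
  Exchangeable U V S ∧ moveSet U V S ∉ 𝓐

open scoped Classical in
/-- The `U → V` compression of a family. -/
noncomputable def compress (U V : Finset ℕ) (𝓐 : Finset (Finset ℕ)) : Finset (Finset ℕ) :=
  𝓐.image fun S => if Movable U V 𝓐 S then moveSet U V S else S

/-- The members of the intersecting family `𝓔` that have to be moved together. -/
inductive Reach (U V : Finset ℕ) (𝓐 𝓔 : Finset (Finset ℕ)) : Finset ℕ → Prop
  | base {S : Finset ℕ} (hS : S ∈ 𝓔) (h : Movable U V 𝓐 S) : Reach U V 𝓐 𝓔 S
  | step {S T : Finset ℕ} (hS : Reach U V 𝓐 𝓔 S) (hT : T ∈ 𝓔) (h : Exchangeable U V T)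
      (hd : Disjoint (S \ U) (T \ U)) : Reach U V 𝓐 𝓔 T

open scoped Classical in
/-- The image of an intersecting family under the compression. -/
noncomputable def compressFam (U V : Finset ℕ) (𝓐 𝓔 : Finset (Finset ℕ)) : Finset (Finset ℕ) :=
  𝓔.image fun S => if Reach U V 𝓐 𝓔 S then moveSet U V S else S

section compression

variable {U V : Finset ℕ} {𝓐 𝓔 : Finset (Finset ℕ)}

theorem Exchangeable.moveSet_inj {S T : Finset ℕ} (hS : Exchangeable U V S)
    (hT : Exchangeable U V T) (h : moveSet U V S = moveSet U V T) : S = T := by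
  have key : ∀ {S : Finset ℕ}, Exchangeable U V S → (moveSet U V S \ V) ∪ U = S := by
    intro S hS
    ext x
    have h1 := @hS.1 x
    have h2 : x ∈ V → x ∉ S := fun h => disjoint_left.1 hS.2 h
    simp only [moveSet, mem_union, mem_sdiff]
    tauto
  rw [← key hS, h, key hT]

theorem Exchangeable.card_moveSet {S : Finset ℕ} (hS : Exchangeable U V S) :
    (moveSet U V S).card + U.card = S.card + V.card := by
  have hd : Disjoint (S \ U) V := (hS.2.mono_right sdiff_subset).symm
  have := card_sdiff_add_card_eq_card hS.1
  rw [moveSet, card_union_of_disjoint hd]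
  omega

theorem subset_moveSet (S : Finset ℕ) : V ⊆ moveSet U V S := subset_union_right

theorem not_movable_of_subset (hV : V.Nonempty) {S : Finset ℕ} (h : V ⊆ S) :
    ¬ Movable U V 𝓐 S := by
  intro hm
  obtain ⟨v, hv⟩ := hV
  exact disjoint_left.1 hm.1.2 hv (h hv)

theorem Reach.mem {S : Finset ℕ} (h : Reach U V 𝓐 𝓔 S) : S ∈ 𝓔 := by
  cases h <;> assumption

theorem Reach.exchangeable {S : Finset ℕ} (h : Reach U V 𝓐 𝓔 S) : Exchangeable U V S := by
  cases h with
  | base hS h => exact h.1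
  | step hS hT h hd => exact h

theorem disjoint_moveSet_of_disjoint {K T : Finset ℕ} (hK : Exchangeable U V K)
    (hd : Disjoint (K \ U) (T \ U)) : Disjoint K (moveSet U V T) := by
  rw [disjoint_left] at hd ⊢
  intro x hx hx'
  have h2 : x ∈ V → x ∉ K := fun h => disjoint_left.1 hK.2 h
  have := @hd x
  simp only [moveSet, mem_union, mem_sdiff] at hx' this
  tauto

theorem Reach.moveSet_notMem (h𝓔 : 𝓔 ⊆ 𝓐) (hmeet : ∀ B ∈ 𝓔, ∀ B' ∈ 𝓔, (B ∩ B').Nonempty)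
    {S : Finset ℕ} (h : Reach U V 𝓐 𝓔 S) : moveSet U V S ∉ 𝓔 := by
  intro hm
  cases h with
  | base hS h => exact h.2 (h𝓔 hm)
  | step hS hT h hd =>
    exact not_disjoint_iff_nonempty_inter.2 (hmeet _ hS.mem _ hm)
      (disjoint_moveSet_of_disjoint hS.exchangeable hd)

theorem mem_compressFam {F : Finset ℕ} :
    F ∈ compressFam U V 𝓐 𝓔 ↔ (F ∈ 𝓔 ∧ ¬ Reach U V 𝓐 𝓔 F) ∨
      ∃ K, Reach U V 𝓐 𝓔 K ∧ F = moveSet U V K := by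
  classical
  rw [compressFam, mem_image]
  constructor
  · rintro ⟨K, hK, rfl⟩
    by_cases h : Reach U V 𝓐 𝓔 K
    · rw [if_pos h]; exact Or.inr ⟨K, h, rfl⟩
    · rw [if_neg h]; exact Or.inl ⟨hK, h⟩
  · rintro (⟨h1, h2⟩ | ⟨K, hK, rfl⟩)
    · exact ⟨F, h1, if_neg h2⟩
    · exact ⟨K, hK.mem, if_pos hK⟩

theorem mem_compress {F : Finset ℕ} :
    F ∈ compress U V 𝓐 ↔ (F ∈ 𝓐 ∧ ¬ Movable U V 𝓐 F) ∨
      ∃ K ∈ 𝓐, Movable U V 𝓐 K ∧ F = moveSet U V K := by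
  classical
  rw [compress, mem_image]
  constructor
  · rintro ⟨K, hK, rfl⟩
    by_cases h : Movable U V 𝓐 K
    · rw [if_pos h]; exact Or.inr ⟨K, hK, h, rfl⟩
    · rw [if_neg h]; exact Or.inl ⟨hK, h⟩
  · rintro (⟨h1, h2⟩ | ⟨K, hK, h, rfl⟩)
    · exact ⟨F, h1, if_neg h2⟩
    · exact ⟨K, hK, if_pos h⟩

theorem injOn_compress (𝓐 : Finset (Finset ℕ)) [DecidablePred (Movable U V 𝓐)] :
    Set.InjOn (fun S => if Movable U V 𝓐 S then moveSet U V S else S) 𝓐 := by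
  intro S hS T hT h
  by_cases h1 : Movable U V 𝓐 S <;> by_cases h2 : Movable U V 𝓐 T <;>
    simp only [h1, h2, if_true, if_false] at h
  · exact h1.1.moveSet_inj h2.1 h
  · exact absurd (h ▸ hT) h1.2
  · exact absurd (h ▸ hS) h2.2
  · exact h

theorem card_compress (U V : Finset ℕ) (𝓐 : Finset (Finset ℕ)) :
    (compress U V 𝓐).card = 𝓐.card := by
  classical
  rw [compress, card_image_of_injOn]
  exact injOn_compress 𝓐

theorem sum_card_lt_sum_card_compress (hUV : U.card < V.card) {S : Finset ℕ} (hS : S ∈ 𝓐)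
    (hm : Movable U V 𝓐 S) : ∑ S ∈ 𝓐, S.card < ∑ S ∈ compress U V 𝓐, S.card := by
  classical
  rw [compress, sum_image (injOn_compress 𝓐)]
  refine sum_lt_sum (fun T hT => ?_) ⟨S, hS, ?_⟩
  · split_ifs with h
    · have := h.1.card_moveSet; omega
    · exact le_rfl
  · rw [if_pos hm]
    have := hm.1.card_moveSet
    omega

theorem compressFam_mem (s : ℕ) (hU : U.card ≤ 1) (hV : V.Nonempty)
    (h : 𝓔 ∈ interFams s 𝓐) : compressFam U V 𝓐 𝓔 ∈ interFams s (compress U V 𝓐) := by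
  classical
  obtain ⟨h1, h2, h3⟩ := mem_interFams.1 h
  have hmix : ∀ F ∈ 𝓔, ¬ Reach U V 𝓐 𝓔 F → ∀ K, Reach U V 𝓐 𝓔 K →
      (F ∩ moveSet U V K).Nonempty := by
    intro F hF hnF K hK
    by_cases hVF : Disjoint V F
    · by_cases hUF : U ⊆ F
      · have := fun hd => hnF (Reach.step hK hF ⟨hUF, hVF⟩ hd)
        obtain ⟨x, hx1, hx2⟩ := not_disjoint_iff.1 this
        refine ⟨x, mem_inter.2 ⟨(mem_sdiff.1 hx2).1, mem_union_left _ hx1⟩⟩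
      · obtain ⟨x, hx⟩ := h3 F hF K hK.mem
        rw [mem_inter] at hx
        refine ⟨x, mem_inter.2 ⟨hx.1, mem_union_left _ (mem_sdiff.2 ⟨hx.2, fun hxU => ?_⟩)⟩⟩
        apply hUF
        intro y hy
        rw [card_le_one.1 hU y hy x hxU]
        exact hx.1
    · obtain ⟨x, hx1, hx2⟩ := not_disjoint_iff.1 hVF
      exact ⟨x, mem_inter.2 ⟨hx2, subset_moveSet K hx1⟩⟩
  refine mem_interFams.2 ⟨?_, ?_, ?_⟩
  · intro F hF
    rcases mem_compressFam.1 hF with ⟨hF, hn⟩ | ⟨K, hK, rfl⟩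
    · exact mem_compress.2 (Or.inl ⟨h1 hF, fun hm => hn (Reach.base hF hm)⟩)
    · by_cases hm : Movable U V 𝓐 K
      · exact mem_compress.2 (Or.inr ⟨K, h1 hK.mem, hm, rfl⟩)
      · refine mem_compress.2 (Or.inl ⟨?_, not_movable_of_subset hV (subset_moveSet K)⟩)
        by_contra hK'
        exact hm ⟨hK.exchangeable, hK'⟩
  · rw [compressFam, card_image_of_injOn, h2]
    intro S hS T hT h
    have hS' : S ∈ 𝓔 := hS
    have hT' : T ∈ 𝓔 := hT
    by_cases hr1 : Reach U V 𝓐 𝓔 S <;> by_cases hr2 : Reach U V 𝓐 𝓔 T <;>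
      simp only [hr1, hr2, if_true, if_false] at h
    · exact hr1.exchangeable.moveSet_inj hr2.exchangeable h
    · exact absurd (h ▸ hT') (hr1.moveSet_notMem h1 h3)
    · exact absurd (h ▸ hS') (hr2.moveSet_notMem h1 h3)
    · exact h
  · intro B hB B' hB'
    rcases mem_compressFam.1 hB with ⟨hB, hn⟩ | ⟨K, hK, rfl⟩ <;>
      rcases mem_compressFam.1 hB' with ⟨hB', hn'⟩ | ⟨K', hK', rfl⟩
    · exact h3 B hB B' hB'
    · exact hmix B hB hn K' hK'
    · rw [inter_comm]; exact hmix B' hB' hn' K hK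
    · obtain ⟨v, hv⟩ := hV
      exact ⟨v, mem_inter.2 ⟨subset_moveSet K hv, subset_moveSet K' hv⟩⟩

theorem injOn_compressFam (U V : Finset ℕ) (s : ℕ) (𝓐 : Finset (Finset ℕ)) :
    Set.InjOn (compressFam U V 𝓐) (interFams s 𝓐) := by
  have key : ∀ 𝓔₁ ∈ interFams s 𝓐, ∀ 𝓔₂ ∈ interFams s 𝓐,
      compressFam U V 𝓐 𝓔₁ = compressFam U V 𝓐 𝓔₂ →
      ∀ K, Reach U V 𝓐 𝓔₁ K → Reach U V 𝓐 𝓔₂ K := by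
    intro 𝓔₁ h₁ 𝓔₂ h₂ heq K hK
    obtain ⟨h₂1, -, h₂3⟩ := mem_interFams.1 h₂
    induction hK with
    | @base S hS h =>
      have : moveSet U V S ∈ compressFam U V 𝓐 𝓔₂ :=
        heq ▸ mem_compressFam.2 (Or.inr ⟨S, Reach.base hS h, rfl⟩)
      rcases mem_compressFam.1 this with ⟨hm, -⟩ | ⟨K, hK, hSK⟩
      · exact absurd (h₂1 hm) h.2
      · rwa [h.1.moveSet_inj hK.exchangeable hSK]
    | @step S T hS hT h hd ih =>
      have : moveSet U V T ∈ compressFam U V 𝓐 𝓔₂ :=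
        heq ▸ mem_compressFam.2 (Or.inr ⟨T, Reach.step hS hT h hd, rfl⟩)
      rcases mem_compressFam.1 this with ⟨hm, -⟩ | ⟨K, hK, hTK⟩
      · exact absurd (disjoint_moveSet_of_disjoint ih.exchangeable hd)
          (not_disjoint_iff_nonempty_inter.2 (h₂3 _ ih.mem _ hm))
      · rwa [h.moveSet_inj hK.exchangeable hTK]
  have key2 : ∀ 𝓔₁ ∈ interFams s 𝓐, ∀ 𝓔₂ ∈ interFams s 𝓐,
      compressFam U V 𝓐 𝓔₁ = compressFam U V 𝓐 𝓔₂ → 𝓔₁ ⊆ 𝓔₂ := by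
    intro 𝓔₁ h₁ 𝓔₂ h₂ heq F hF
    obtain ⟨h₁1, -, h₁3⟩ := mem_interFams.1 h₁
    by_cases hr : Reach U V 𝓐 𝓔₁ F
    · exact (key 𝓔₁ h₁ 𝓔₂ h₂ heq F hr).mem
    · have : F ∈ compressFam U V 𝓐 𝓔₂ := heq ▸ mem_compressFam.2 (Or.inl ⟨hF, hr⟩)
      rcases mem_compressFam.1 this with ⟨hm, -⟩ | ⟨K, hK, rfl⟩
      · exact hm
      · exact absurd hF ((key 𝓔₂ h₂ 𝓔₁ h₁ heq.symm K hK).moveSet_notMem h₁1 h₁3)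
  intro 𝓔₁ h₁ 𝓔₂ h₂ heq
  exact Subset.antisymm (key2 𝓔₁ h₁ 𝓔₂ h₂ heq) (key2 𝓔₂ h₂ 𝓔₁ h₁ heq.symm)

theorem card_interFams_le_compress (s : ℕ) (hU : U.card ≤ 1) (hV : V.Nonempty) :
    (interFams s 𝓐).card ≤ (interFams s (compress U V 𝓐)).card :=
  card_le_card_of_injOn _ (fun _ h => compressFam_mem s hU hV h) (injOn_compressFam U V s 𝓐)

theorem card_interFams_lt_compress {s : ℕ} (hU : U.card ≤ 1) (hV : V.Nonempty)
    {𝓔' : Finset (Finset ℕ)} (h𝓔' : 𝓔' ∈ interFams s (compress U V 𝓐))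
    (h : ∀ 𝓔 ∈ interFams s 𝓐,
      ∃ F ∈ 𝓔', F ∉ 𝓔 ∧ ∀ K ∈ 𝓔, Exchangeable U V K → F ≠ moveSet U V K) :
    (interFams s 𝓐).card < (interFams s (compress U V 𝓐)).card := by
  rw [← card_image_of_injOn (injOn_compressFam U V s 𝓐)]
  refine card_lt_card (Finset.ssubset_iff_subset_ne.2 ⟨?_, fun heq => ?_⟩)
  · intro 𝓕 h𝓕
    obtain ⟨𝓔, h𝓔, rfl⟩ := mem_image.1 h𝓕
    exact compressFam_mem s hU hV h𝓔
  · rw [← heq] at h𝓔'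
    obtain ⟨𝓔, h𝓔, rfl⟩ := mem_image.1 h𝓔'
    obtain ⟨F, hF, hF1, hF2⟩ := h 𝓔 h𝓔
    rcases mem_compressFam.1 hF with ⟨hF, -⟩ | ⟨K, hK, rfl⟩
    · exact hF1 hF
    · exact hF2 K hK.mem hK.exchangeable rfl

end compression

/-- Closure under adding points of `R` and under exchanging a point of `R` for two. -/
def ExchangeClosed (R : Finset ℕ) (𝓗 : Finset (Finset ℕ)) : Prop :=
  ∀ U V : Finset ℕ, U.card ≤ 1 → V.card = U.card + 1 → U ⊆ R → V ⊆ R → Disjoint U V →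
    ∀ S ∈ 𝓗, Exchangeable U V S → moveSet U V S ∈ 𝓗

theorem ExchangeClosed.mem_of_subset {R : Finset ℕ} {𝓗 : Finset (Finset ℕ)}
    (h : ExchangeClosed R 𝓗) {S T : Finset ℕ} (hS : S ∈ 𝓗) (hST : S ⊆ T) (hR : T \ S ⊆ R) :
    T ∈ 𝓗 := by
  obtain ⟨k, hk⟩ : ∃ k, (T \ S).card = k := ⟨_, rfl⟩
  induction k generalizing S with
  | zero =>
    rw [card_eq_zero, sdiff_eq_empty_iff_subset] at hk
    rwa [← Subset.antisymm hST hk]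
  | succ k ih =>
    obtain ⟨v, hv⟩ : (T \ S).Nonempty := card_pos.1 (by omega)
    obtain ⟨hvT, hvS⟩ := mem_sdiff.1 hv
    have hm := h ∅ {v} (by simp) (by simp) (by simp) (by simpa using hR hv) (by simp) S hS
      ⟨by simp, by simpa using hvS⟩
    have e : moveSet ∅ {v} S = insert v S := by
      ext x; simp [moveSet]
    rw [e] at hm
    have e2 : T \ insert v S = (T \ S).erase v := by
      ext x; simp only [mem_sdiff, mem_insert, mem_erase]; tauto
    refine ih hm (insert_subset hvT hST) ?_ ?_
    · rw [e2]; exact (erase_subset _ _).trans hR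
    · rw [e2, card_erase_of_mem hv]; omega

theorem ExchangeClosed.mem_of_two_mul_le {R : Finset ℕ} {𝓗 : Finset (Finset ℕ)}
    (h : ExchangeClosed R 𝓗) {S T : Finset ℕ} (hS : S ∈ 𝓗) (hSR : S \ T ⊆ R) (hTR : T \ S ⊆ R)
    (hcard : 2 * (S \ T).card ≤ (T \ S).card) : T ∈ 𝓗 := by
  obtain ⟨k, hk⟩ : ∃ k, (S \ T).card = k := ⟨_, rfl⟩
  induction k generalizing S with
  | zero =>
    rw [card_eq_zero, sdiff_eq_empty_iff_subset] at hk
    exact h.mem_of_subset hS hk hTR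
  | succ k ih =>
    obtain ⟨u, hu⟩ : (S \ T).Nonempty := card_pos.1 (by omega)
    obtain ⟨V, hVs, hV2⟩ := exists_subset_card_eq (s := T \ S) (n := 2) (by omega)
    obtain ⟨huS, huT⟩ := mem_sdiff.1 hu
    have hVT : ∀ x ∈ V, x ∈ T ∧ x ∉ S := fun x hx => mem_sdiff.1 (hVs hx)
    have hm := h {u} V (by simp) (by simpa using hV2) (by simpa using hSR hu)
      (hVs.trans hTR) (by simpa using fun h => (hVT u h).2 huS) S hS
      ⟨by simpa using huS, disjoint_left.2 fun x hx => (hVT x hx).2⟩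
    have e1 : moveSet {u} V S \ T = (S \ T).erase u := by
      ext x
      have := hVT x
      simp only [moveSet, mem_sdiff, mem_union, mem_erase, mem_singleton]
      tauto
    have e2 : T \ moveSet {u} V S = (T \ S) \ V := by
      ext x
      have := hVT x
      simp only [moveSet, mem_sdiff, mem_union, mem_singleton]
      by_cases hxu : x = u
      · subst hxu; tauto
      · tauto
    have hc2 := card_sdiff_add_card_eq_card hVs
    refine ih hm ?_ ?_ ?_ ?_
    · rw [e1]; exact (erase_subset _ _).trans hSR
    · rw [e2]; exact sdiff_subset.trans hTR
    · rw [e1, e2, card_erase_of_mem hu]; omega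
    · rw [e1, card_erase_of_mem hu]; omega

theorem card_groundSet (n : ℕ) : (groundSet n).card = n := by simp [groundSet]

/-- A compression that moves a small set into an up-set containing all triples gains. -/
theorem card_interFams_lt_compress_of_movable {n s : ℕ} (hn : 21 ≤ n) (hs1 : 2 ≤ s)
    (hs2 : s ≤ 2 ^ (n - 1)) {U V : Finset ℕ} (hU : U.card ≤ 1) (hV : V.card = U.card + 1)
    (hVg : V ⊆ groundSet n) {𝓐 : Finset (Finset ℕ)} (h𝓐 : 𝓐 ⊆ allFams n)
    (h3 : layerGE n 3 ⊆ compress U V 𝓐)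
    (hup : ∀ S ∈ compress U V 𝓐, ∀ T ⊆ groundSet n, S ⊆ T → T ∈ compress U V 𝓐)
    {S : Finset ℕ} (hS : S ∈ 𝓐) (hS2 : S.card ≤ 2) (hm : Movable U V 𝓐 S) :
    (interFams s 𝓐).card < (interFams s (compress U V 𝓐)).card := by
  have hVne : V.Nonempty := card_pos.1 (by omega)
  obtain ⟨v, hv⟩ := hVne
  have hSg : S ⊆ groundSet n := mem_powerset.1 (h𝓐 hS)
  have hS'g : moveSet U V S ⊆ groundSet n := union_subset (sdiff_subset.trans hSg) hVg
  have hS' : moveSet U V S ∈ compress U V 𝓐 := mem_compress.2 (Or.inr ⟨S, hS, hm, rfl⟩)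
  set F := groundSet n \ (S ∪ V.erase v) with hF
  have hFg : F ⊆ groundSet n := sdiff_subset
  have hFcard : 3 ≤ F.card := by
    have h1 := le_card_sdiff (S ∪ V.erase v) (groundSet n)
    have h2 := card_union_le S (V.erase v)
    rw [card_erase_of_mem hv] at h2
    rw [card_groundSet, ← hF] at h1
    omega
  have hvF : v ∈ F := by
    simp [hF, hVg hv, disjoint_left.1 hm.1.2 hv]
  have hFS : ∀ x ∈ F, x ∉ S := by
    intro x hx hxS
    simp [hF, hxS] at hx
  obtain ⟨𝓔', hc, hS𝓔, hF𝓔, hmeet, hmem⟩ := exists_interFam_of_pair (by omega) hs1 hs2 hS'g hFg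
    ⟨v, mem_inter.2 ⟨subset_moveSet S hv, hvF⟩⟩
  refine card_interFams_lt_compress hU ⟨v, hv⟩ (𝓔' := 𝓔')
    (mem_interFams.2 ⟨fun Z hZ => ?_, hc, hmeet⟩) fun 𝓔 h𝓔 => ?_
  · obtain ⟨hZg, hZ⟩ := hmem Z hZ
    rcases hZ with hZ | hZ | hZ
    · exact hup _ hS' Z hZg hZ
    · exact h3 (mem_filter.2 ⟨mem_powerset.2 hZg, hFcard.trans (card_le_card hZ)⟩)
    · exact h3 (mem_filter.2 ⟨mem_powerset.2 hZg, by omega⟩)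
  · obtain ⟨h1, -, hi⟩ := mem_interFams.1 h𝓔
    by_cases hSm : S ∈ 𝓔
    · refine ⟨F, hF𝓔, fun hF1 => ?_, fun K hK hKe hFK => ?_⟩
      · obtain ⟨x, hx⟩ := hi F hF1 S hSm
        exact hFS x (mem_inter.1 hx).1 (mem_inter.1 hx).2
      · have hV1 : ∀ x ∈ V, x = v := by
          intro x hx
          by_contra hne
          have : x ∈ F := hFK ▸ subset_moveSet K hx
          simp [hF, hne, hx] at this
        have hVc : V.card ≤ 1 := card_le_one.2 fun a ha b hb => (hV1 a ha).trans (hV1 b hb).symm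
        have hU0 : U = ∅ := card_eq_zero.1 (by omega)
        obtain ⟨x, hx⟩ := hi K hK S hSm
        refine hFS x ?_ (mem_inter.1 hx).2
        rw [hFK, hU0, moveSet]
        simp [(mem_inter.1 hx).1]
    · refine ⟨_, hS𝓔, fun h => hm.2 (h1 h), fun K hK hKe hSK => ?_⟩
      rw [hm.1.moveSet_inj hKe hSK] at hSm
      exact hSm hK

theorem exists_perm_image_eq {α : Type*} [DecidableEq α] {s t : Finset α} (h : s.card = t.card) :
    ∃ σ : Equiv.Perm α, s.image σ = t ∧ ∀ x, x ∉ s → x ∉ t → σ x = x := by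
  obtain ⟨k, hk⟩ : ∃ k, (s \ t).card = k := ⟨_, rfl⟩
  induction k generalizing s with
  | zero =>
    rw [card_eq_zero, sdiff_eq_empty_iff_subset] at hk
    exact ⟨1, by simpa using eq_of_subset_of_card_le hk h.ge, fun _ _ _ => rfl⟩
  | succ k ih =>
    have hts : (t \ s).card = k + 1 := by rw [← card_sdiff_comm h, hk]
    obtain ⟨x, hx⟩ : (s \ t).Nonempty := card_pos.1 (by omega)
    obtain ⟨y, hy⟩ : (t \ s).Nonempty := card_pos.1 (by omega)
    rw [mem_sdiff] at hx hy
    have himg : s.image (Equiv.swap x y) = insert y (s.erase x) := by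
      ext z
      simp only [mem_image, mem_insert, mem_erase]
      constructor
      · rintro ⟨w, hw, rfl⟩
        by_cases hwx : w = x
        · left; simp [hwx]
        · have hwy : w ≠ y := fun h => hy.2 (h ▸ hw)
          rw [Equiv.swap_apply_of_ne_of_ne hwx hwy]
          exact Or.inr ⟨hwx, hw⟩
      · rintro (rfl | ⟨hzx, hz⟩)
        · exact ⟨x, hx.1, by simp⟩
        · exact ⟨z, hz, Equiv.swap_apply_of_ne_of_ne hzx fun h => hy.2 (h ▸ hz)⟩
    obtain ⟨σ, h1, h2⟩ := ih (s := s.image (Equiv.swap x y))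
      (by rw [card_image_of_injective _ (Equiv.injective _), h]) (by
        rw [himg, show insert y (s.erase x) \ t = (s \ t).erase x by
          ext z; simp only [mem_sdiff, mem_insert, mem_erase]
          constructor
          · rintro ⟨rfl | h, h'⟩
            · exact absurd hy.1 h'
            · exact ⟨h.1, h.2, h'⟩
          · rintro ⟨h, h', h''⟩
            exact ⟨Or.inr ⟨h, h'⟩, h''⟩,
          card_erase_of_mem (mem_sdiff.2 hx), hk]; rfl)
    refine ⟨(Equiv.swap x y).trans σ, ?_, fun z hz1 hz2 => ?_⟩
    · rw [Equiv.coe_trans, ← image_image, h1]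
    · have hzx : z ≠ x := fun h => hz1 (h ▸ hx.1)
      have hzy : z ≠ y := fun h => hz2 (h ▸ hy.1)
      rw [Equiv.trans_apply, Equiv.swap_apply_of_ne_of_ne hzx hzy]
      refine h2 z ?_ hz2
      rw [himg]
      simp [hzy, hz1]

/-- A permutation fixing everything outside `g` maps `g` to itself. -/
theorem perm_mem_of_fix {α : Type*} {σ : Equiv.Perm α} {g : Finset α}
    (h : ∀ x, x ∉ g → σ x = x) {x : α} (hx : x ∈ g) : σ x ∈ g := by
  by_contra hn
  have := σ.injective (h _ hn)
  exact hn (this.symm ▸ hx)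

/-- Intersecting families of `𝓩 ∪ H` that contain all of `H`. -/
def famsThrough (s : ℕ) (𝓩 H : Finset (Finset ℕ)) : Finset (Finset (Finset ℕ)) :=
  (interFams s (𝓩 ∪ H)).filter fun 𝓔 => H ⊆ 𝓔

theorem card_interFams_eq_sum_famsThrough (s : ℕ) {𝓩 G : Finset (Finset ℕ)} (hd : Disjoint 𝓩 G) :
    (interFams s (𝓩 ∪ G)).card = ∑ H ∈ G.powerset, (famsThrough s 𝓩 H).card := by
  rw [card_eq_sum_card_fiberwise (f := fun 𝓔 => 𝓔 ∩ G) (t := G.powerset)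
    (fun 𝓔 _ => by simp)]
  refine sum_congr rfl fun H hH => ?_
  rw [mem_powerset] at hH
  congr 1
  ext 𝓔
  simp only [famsThrough, mem_filter, mem_interFams]
  constructor
  · rintro ⟨⟨h1, h2, h3⟩, rfl⟩
    refine ⟨⟨fun F hF => ?_, h2, h3⟩, inter_subset_left⟩
    rcases mem_union.1 (h1 hF) with h | h
    · exact mem_union_left _ h
    · exact mem_union_right _ (mem_inter.2 ⟨hF, h⟩)
  · rintro ⟨⟨h1, h2, h3⟩, h4⟩
    refine ⟨⟨h1.trans (union_subset_union_right hH), h2, h3⟩, ?_⟩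
    refine Subset.antisymm (fun F hF => ?_) (subset_inter h4 hH)
    rw [mem_inter] at hF
    rcases mem_union.1 (h1 hF.1) with h | h
    · exact absurd hF.2 (disjoint_left.1 hd h)
    · exact h

theorem card_famsThrough_le_of_map (s : ℕ) {𝓩 H H' : Finset (Finset ℕ)} (θ : Finset ℕ → Finset ℕ)
    (hH : H.image θ = H')
    (hmaps : ∀ F ∈ 𝓩, (∀ A ∈ H, (F ∩ A).Nonempty) → θ F ∈ 𝓩)
    (hinj : ∀ F ∈ 𝓩 ∪ H, (∀ A ∈ H, (F ∩ A).Nonempty) → ∀ F' ∈ 𝓩 ∪ H,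
      (∀ A ∈ H, (F' ∩ A).Nonempty) → θ F = θ F' → F = F')
    (hmeet : ∀ F ∈ 𝓩 ∪ H, (∀ A ∈ H, (F ∩ A).Nonempty) → ∀ F' ∈ 𝓩 ∪ H,
      (∀ A ∈ H, (F' ∩ A).Nonempty) → (F ∩ F').Nonempty → (θ F ∩ θ F').Nonempty) :
    (famsThrough s 𝓩 H).card ≤ (famsThrough s 𝓩 H').card := by
  have hdom : ∀ 𝓔 ∈ famsThrough s 𝓩 H, ∀ F ∈ 𝓔, F ∈ 𝓩 ∪ H ∧ ∀ A ∈ H, (F ∩ A).Nonempty := by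
    intro 𝓔 h𝓔 F hF
    obtain ⟨h, h4⟩ := mem_filter.1 h𝓔
    obtain ⟨h1, -, h3⟩ := mem_interFams.1 h
    exact ⟨h1 hF, fun A hA => h3 F hF A (h4 hA)⟩
  refine card_le_card_of_injOn (fun 𝓔 => 𝓔.image θ) ?_ ?_
  · intro 𝓔 h𝓔
    have hd := hdom 𝓔 h𝓔
    obtain ⟨h, h4⟩ := mem_filter.1 h𝓔
    obtain ⟨h1, h2, h3⟩ := mem_interFams.1 h
    refine mem_filter.2 ⟨mem_interFams.2 ⟨?_, ?_, ?_⟩, ?_⟩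
    · intro F hF
      obtain ⟨G, hG, rfl⟩ := mem_image.1 hF
      rcases mem_union.1 (h1 hG) with hZ | hZ
      · exact mem_union_left _ (hmaps G hZ (hd G hG).2)
      · exact mem_union_right _ (hH ▸ mem_image_of_mem θ hZ)
    · rw [card_image_of_injOn, h2]
      intro F hF F' hF' e
      exact hinj F (hd F hF).1 (hd F hF).2 F' (hd F' hF').1 (hd F' hF').2 e
    · intro B hB B' hB'
      obtain ⟨G, hG, rfl⟩ := mem_image.1 hB
      obtain ⟨G', hG', rfl⟩ := mem_image.1 hB'
      exact hmeet G (hd G hG).1 (hd G hG).2 G' (hd G' hG').1 (hd G' hG').2 (h3 G hG G' hG')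
    · rw [← hH]
      exact image_subset_image h4
  · have key : ∀ 𝓕 ∈ famsThrough s 𝓩 H, ∀ 𝓕' ∈ famsThrough s 𝓩 H,
        𝓕.image θ = 𝓕'.image θ → 𝓕 ⊆ 𝓕' := by
      intro 𝓕 h 𝓕' h' e F hF
      have : θ F ∈ 𝓕'.image θ := e ▸ mem_image_of_mem θ hF
      obtain ⟨G, hG, hGF⟩ := mem_image.1 this
      have h1 := hdom 𝓕 h F hF
      have h2 := hdom 𝓕' h' G hG
      rwa [← hinj G h2.1 h2.2 F h1.1 h1.2 hGF]
    intro 𝓔 h𝓔 𝓔' h𝓔' heq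
    exact Subset.antisymm (key _ h𝓔 _ h𝓔' heq) (key _ h𝓔' _ h𝓔 heq.symm)

theorem mem_layerGE {n r : ℕ} {F : Finset ℕ} :
    F ∈ layerGE n r ↔ F ⊆ groundSet n ∧ r ≤ F.card := by
  simp [layerGE, allFams]

theorem mem_layerEQ {n r : ℕ} {F : Finset ℕ} :
    F ∈ layerEQ n r ↔ F ⊆ groundSet n ∧ F.card = r := by
  simp [layerEQ, mem_powersetCard]

theorem disjoint_layerGE_three {n : ℕ} {G : Finset (Finset ℕ)} (hG : G ⊆ layerEQ n 2) :
    Disjoint (layerGE n 3) G := by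
  refine disjoint_left.2 fun F hF hF' => ?_
  have h1 := (mem_layerGE.1 hF).2
  have h2 := (mem_layerEQ.1 (hG hF')).2
  omega

/-- A pair through `c` is `{c, x}`. -/
theorem exists_eq_pair_of_mem {n c : ℕ} {A : Finset ℕ} (hA : A ∈ layerEQ n 2) (hc : c ∈ A) :
    ∃ x ∈ groundSet n, x ≠ c ∧ A = {c, x} := by
  obtain ⟨h1, h2⟩ := mem_layerEQ.1 hA
  obtain ⟨x, hx⟩ : (A.erase c).Nonempty := card_pos.1 (by rw [card_erase_of_mem hc]; omega)
  obtain ⟨hxc, hxA⟩ := mem_erase.1 hx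
  refine ⟨x, h1 hxA, hxc, (eq_of_subset_of_card_le ?_ ?_).symm⟩
  · exact insert_subset hc (singleton_subset_iff.2 hxA)
  · rw [card_pair hxc.symm, h2]

theorem eq_image_leaves {n c : ℕ} {H : Finset (Finset ℕ)} (hH : H ⊆ layerEQ n 2)
    (hc : ∀ A ∈ H, c ∈ A) :
    ∃ L ⊆ (groundSet n).erase c, H = L.image fun x => {c, x} := by
  refine ⟨((groundSet n).erase c).filter fun x => {c, x} ∈ H, filter_subset _ _, ?_⟩
  ext A
  constructor
  · intro hA
    obtain ⟨x, hx, hxc, rfl⟩ := exists_eq_pair_of_mem (hH hA) (hc A hA)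
    exact mem_image.2 ⟨x, mem_filter.2 ⟨mem_erase.2 ⟨hxc, hx⟩, hA⟩, rfl⟩
  · intro hA
    obtain ⟨x, hx, rfl⟩ := mem_image.1 hA
    exact (mem_filter.1 hx).2

theorem injOn_pair (c : ℕ) (g : Finset ℕ) :
    Set.InjOn (fun x : ℕ => ({c, x} : Finset ℕ)) (g.erase c) := by
  intro x hx y hy h
  have hxc := (mem_erase.1 (mem_coe.1 hx)).1
  have : x ∈ ({c, y} : Finset ℕ) := by
    have h' : ({c, x} : Finset ℕ) = {c, y} := h
    rw [← h']; simp
  simpa [hxc] using this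

theorem card_famsThrough_le_of_star (s : ℕ) {n c d : ℕ} {H H' : Finset (Finset ℕ)}
    (hc : c ∈ groundSet n) (hd : d ∈ groundSet n) (hH : H ⊆ layerEQ n 2) (hH' : H' ⊆ layerEQ n 2)
    (hcH : ∀ A ∈ H, c ∈ A) (hdH' : ∀ A ∈ H', d ∈ A) (hcard : H.card = H'.card) :
    (famsThrough s (layerGE n 3) H).card ≤ (famsThrough s (layerGE n 3) H').card := by
  obtain ⟨L, hL, rfl⟩ := eq_image_leaves hH hcH
  obtain ⟨L', hL', rfl⟩ := eq_image_leaves hH' hdH'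
  rw [card_image_of_injOn ((injOn_pair _ _).mono (by exact_mod_cast hL)),
    card_image_of_injOn ((injOn_pair _ _).mono (by exact_mod_cast hL'))] at hcard
  have hsw : ∀ x, x ∉ groundSet n → Equiv.swap c d x = x := fun x hx =>
    Equiv.swap_apply_of_ne_of_ne (fun h => hx (h ▸ hc)) fun h => hx (h ▸ hd)
  have hL1 : L.image (Equiv.swap c d) ⊆ (groundSet n).erase d := by
    intro x hx
    obtain ⟨y, hy, rfl⟩ := mem_image.1 hx
    obtain ⟨hy1, hy2⟩ := mem_erase.1 (hL hy)
    refine mem_erase.2 ⟨fun h => hy1 ?_, perm_mem_of_fix hsw hy2⟩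
    exact (Equiv.swap c d).injective (h.trans (Equiv.swap_apply_left c d).symm)
  obtain ⟨σ, h1, h2⟩ := exists_perm_image_eq (s := L.image (Equiv.swap c d)) (t := L')
    (by rw [card_image_of_injective _ (Equiv.injective _), hcard])
  have hσ : ∀ x, x ∉ groundSet n → σ x = x := fun x hx =>
    h2 x (fun h => hx (mem_of_mem_erase (hL1 h))) fun h => hx (mem_of_mem_erase (hL' h))
  have hσd : σ d = d := h2 d (fun h => notMem_erase d _ (hL1 h)) fun h => notMem_erase d _ (hL' h)
  set τ : Equiv.Perm ℕ := (Equiv.swap c d).trans σ with hτ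
  have hτc : τ c = d := by simp [hτ, hσd]
  refine card_famsThrough_le_of_map s (fun F => F.image τ) ?_ ?_ ?_ ?_
  · rw [← h1, image_image, image_image, image_image]
    refine image_congr fun x _ => ?_
    simp [image_insert, hτc]
    simp [hτ]
  · intro F hF _
    obtain ⟨hF1, hF2⟩ := mem_layerGE.1 hF
    refine mem_layerGE.2 ⟨fun x hx => ?_, by rwa [card_image_of_injective _ τ.injective]⟩
    obtain ⟨y, hy, rfl⟩ := mem_image.1 hx
    exact perm_mem_of_fix hσ (perm_mem_of_fix hsw (hF1 hy))
  · exact fun F _ _ F' _ _ h => image_injective τ.injective h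
  · exact fun F _ _ F' _ _ h => inter_image_perm_nonempty τ h

theorem card_famsThrough_eq_zero_of_disjoint (s : ℕ) {𝓩 H : Finset (Finset ℕ)} {A B : Finset ℕ}
    (hA : A ∈ H) (hB : B ∈ H) (h : ¬ (A ∩ B).Nonempty) : (famsThrough s 𝓩 H).card = 0 := by
  rw [card_eq_zero, famsThrough, filter_eq_empty_iff]
  intro 𝓔 h𝓔 hH
  exact h ((mem_interFams.1 h𝓔).2.2 A (hH hA) B (hH hB))

/-- Pairwise intersecting pairs without a common point form a triangle. -/
theorem eq_triangle_of_intersecting {n : ℕ} {H : Finset (Finset ℕ)} (hH : H ⊆ layerEQ n 2)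
    (hn : 1 ≤ n) (hmeet : ∀ A ∈ H, ∀ B ∈ H, (A ∩ B).Nonempty)
    (hne : ¬ ∃ c ∈ groundSet n, ∀ A ∈ H, c ∈ A) :
    ∃ x ∈ groundSet n, ∃ y ∈ groundSet n, ∃ z ∈ groundSet n, x ≠ y ∧ x ≠ z ∧ y ≠ z ∧
      H = {{x, y}, {x, z}, {y, z}} := by
  push Not at hne
  have h1g : 1 ∈ groundSet n := by simp [groundSet, hn]
  obtain ⟨A, hA, -⟩ := hne 1 h1g
  obtain ⟨hAg, hA2⟩ := mem_layerEQ.1 (hH hA)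
  obtain ⟨x, hx⟩ : A.Nonempty := card_pos.1 (by omega)
  obtain ⟨y, hy, hyx, rfl⟩ := exists_eq_pair_of_mem (hH hA) hx
  have hxg := hAg hx
  obtain ⟨B, hB, hyB⟩ := hne y hy
  have hxB : x ∈ B := by
    obtain ⟨w, hw⟩ := hmeet _ hA _ hB
    simp only [mem_inter, mem_insert, mem_singleton] at hw
    rcases hw with ⟨rfl | rfl, hw⟩
    · exact hw
    · exact absurd hw hyB
  obtain ⟨z, hz, hzx, rfl⟩ := exists_eq_pair_of_mem (hH hB) hxB
  have hyz : y ≠ z := by rintro rfl; simp at hyB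
  obtain ⟨C, hC, hxC⟩ := hne x hxg
  have hyC : y ∈ C := by
    obtain ⟨w, hw⟩ := hmeet _ hA _ hC
    simp only [mem_inter, mem_insert, mem_singleton] at hw
    rcases hw with ⟨rfl | rfl, hw⟩
    · exact absurd hw hxC
    · exact hw
  have hzC : z ∈ C := by
    obtain ⟨w, hw⟩ := hmeet _ hB _ hC
    simp only [mem_inter, mem_insert, mem_singleton] at hw
    rcases hw with ⟨rfl | rfl, hw⟩
    · exact absurd hw hxC
    · exact hw
  have hCe : C = {y, z} := (eq_of_subset_of_card_le
    (insert_subset hyC (singleton_subset_iff.2 hzC))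
    (by rw [card_pair hyz, (mem_layerEQ.1 (hH hC)).2])).symm
  subst hCe
  refine ⟨x, hxg, y, hy, z, hz, hyx.symm, hzx.symm, hyz, ?_⟩
  refine Subset.antisymm (fun D hD => ?_) ?_
  · have d1 := hmeet _ hA _ hD
    have d2 := hmeet _ hB _ hD
    have d3 := hmeet _ hC _ hD
    have two : ∀ p q : ℕ, p ≠ q → p ∈ D → q ∈ D → D = {p, q} := fun p q hpq hp hq =>
      (eq_of_subset_of_card_le (insert_subset hp (singleton_subset_iff.2 hq))
        (by rw [card_pair hpq, (mem_layerEQ.1 (hH hD)).2])).symm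
    have pick : ∀ p q : ℕ, (({p, q} : Finset ℕ) ∩ D).Nonempty → p ∈ D ∨ q ∈ D := by
      rintro p q ⟨w, hw⟩
      simp only [mem_inter, mem_insert, mem_singleton] at hw
      rcases hw with ⟨rfl | rfl, hw⟩
      · exact Or.inl hw
      · exact Or.inr hw
    simp only [mem_insert, mem_singleton]
    rcases pick _ _ d1 with h1 | h1
    · rcases pick _ _ d3 with h3 | h3
      · exact Or.inl (two _ _ hyx.symm h1 h3)
      · exact Or.inr (Or.inl (two _ _ hzx.symm h1 h3))
    · rcases pick _ _ d2 with h2 | h2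
      · exact Or.inl (two _ _ hyx.symm h2 h1)
      · exact Or.inr (Or.inr (two _ _ hyz h1 h2))
  · intro D hD
    simp only [mem_insert, mem_singleton] at hD
    rcases hD with rfl | rfl | rfl <;> assumption

theorem card_famsThrough_triangle_le (s : ℕ) {n x y z w : ℕ} (hn : 5 ≤ n) (hx : x ∈ groundSet n)
    (hy : y ∈ groundSet n) (hz : z ∈ groundSet n) (hw : w ∈ groundSet n) (hxy : x ≠ y)
    (hxz : x ≠ z) (hyz : y ≠ z) (hwx : w ≠ x) (hwy : w ≠ y) (hwz : w ≠ z) :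
    (famsThrough s (layerGE n 3) {{x, y}, {x, z}, {y, z}}).card ≤
      (famsThrough s (layerGE n 3) {{x, y}, {x, z}, {x, w}}).card := by
  classical
  set g := groundSet n with hg
  have hgc : g.card = n := card_groundSet n
  set H : Finset (Finset ℕ) := {{x, y}, {x, z}, {y, z}} with hH
  have hyzg : ({y, z} : Finset ℕ) ⊆ g := insert_subset hy (singleton_subset_iff.2 hz)
  have hxwg : ({x, w} : Finset ℕ) ⊆ g := insert_subset hx (singleton_subset_iff.2 hw)
  set π : Equiv.Perm (Finset ℕ) := Equiv.swap {y, z} (g \ {x, w}) with hπ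
  set φ : Finset ℕ → Finset ℕ := fun F => if x ∈ F ∨ w ∈ F then F else g \ π F with hφ
  have hdomg : ∀ F ∈ layerGE n 3 ∪ H, F ⊆ g := by
    intro F hF
    rcases mem_union.1 hF with h | h
    · exact (mem_layerGE.1 h).1
    · simp only [hH, mem_insert, mem_singleton] at h
      rcases h with rfl | rfl | rfl <;> intro a ha <;> simp only [mem_insert, mem_singleton] at ha <;>
        rcases ha with rfl | rfl <;> assumption
  have pick : ∀ {F : Finset ℕ} {p q : ℕ}, (F ∩ {p, q}).Nonempty → p ∈ F ∨ q ∈ F := by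
    rintro F p q ⟨a, ha⟩
    simp only [mem_inter, mem_insert, mem_singleton] at ha
    rcases ha with ⟨h, rfl | rfl⟩
    · exact Or.inl h
    · exact Or.inr h
  have hdom : ∀ F, (∀ A ∈ H, (F ∩ A).Nonempty) →
      (x ∉ F → y ∈ F ∧ z ∈ F) ∧ (y ∈ F ∨ z ∈ F) := fun F hF =>
    ⟨fun h => ⟨(pick (hF _ (by simp [hH]))).resolve_left h,
      (pick (hF _ (by simp [hH]))).resolve_left h⟩, pick (hF _ (by simp [hH]))⟩
  have hπF : ∀ F ⊆ g, y ∈ F → z ∈ F → x ∉ F → w ∉ F →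
      π F ⊆ g ∧ y ∈ π F ∧ z ∈ π F ∧ x ∉ π F ∧ w ∉ π F := by
    intro F hF h1 h2 h3 h4
    by_cases e1 : F = {y, z}
    · rw [hπ, e1, Equiv.swap_apply_left]
      simp [hxy.symm, hxz.symm, hwy.symm, hwz.symm, hy, hz, sdiff_subset]
    by_cases e2 : F = g \ {x, w}
    · rw [hπ, e2, Equiv.swap_apply_right]
      simp [hxy, hxz, hwy, hwz, hyzg]
    rw [hπ, Equiv.swap_apply_of_ne_of_ne e1 e2]
    exact ⟨hF, h1, h2, h3, h4⟩
  have hφ1 : ∀ F, (x ∈ F ∨ w ∈ F) → φ F = F := fun F h => if_pos h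
  have hφ2 : ∀ F, ¬ (x ∈ F ∨ w ∈ F) → φ F = g \ π F := fun F h => if_neg h
  clear_value φ
  refine card_famsThrough_le_of_map s φ ?_ ?_ ?_ ?_
  · have e1 : φ {x, y} = {x, y} := hφ1 _ (by simp)
    have e2 : φ {x, z} = {x, z} := hφ1 _ (by simp)
    have e3 : φ {y, z} = {x, w} := by
      have h1 : ¬ (x ∈ ({y, z} : Finset ℕ) ∨ w ∈ ({y, z} : Finset ℕ)) := by
        simp [hxy, hxz, hwy, hwz]
      rw [hφ2 _ h1, hπ, Equiv.swap_apply_left, sdiff_sdiff_right_self]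
      exact inf_eq_right.2 hxwg
    rw [hH, image_insert, image_insert, image_singleton, e1, e2, e3]
  · intro F hF hFH
    obtain ⟨hFg, hF3⟩ := mem_layerGE.1 hF
    by_cases h : x ∈ F ∨ w ∈ F
    · rwa [hφ1 F h]
    rw [hφ2 F h]
    rw [not_or] at h
    refine mem_layerGE.2 ⟨sdiff_subset, ?_⟩
    have e1 : F ≠ {y, z} := by
      rintro rfl
      rw [card_pair hyz] at hF3; omega
    by_cases e2 : F = g \ {x, w}
    · rw [hπ, e2, Equiv.swap_apply_right, card_sdiff_of_subset hyzg, hgc, card_pair hyz]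
      omega
    · rw [hπ, Equiv.swap_apply_of_ne_of_ne e1 e2, card_sdiff_of_subset hFg, hgc]
      have hs : F ⊂ g \ {x, w} := by
        refine Finset.ssubset_iff_subset_ne.2 ⟨fun a ha => mem_sdiff.2 ⟨hFg ha, ?_⟩, e2⟩
        simp only [mem_insert, mem_singleton]
        rintro (rfl | rfl)
        · exact h.1 ha
        · exact h.2 ha
      have := card_lt_card hs
      rw [card_sdiff_of_subset hxwg, hgc, card_pair hwx.symm] at this
      omega
  · intro F hF hFH F' hF' hFH' he
    have d := hdom F hFH
    have d' := hdom F' hFH'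
    have g1 := hdomg F hF
    have g1' := hdomg F' hF'
    by_cases h : x ∈ F ∨ w ∈ F <;> by_cases h' : x ∈ F' ∨ w ∈ F'
    · rwa [hφ1 F h, hφ1 F' h'] at he
    · rw [hφ1 F h, hφ2 F' h'] at he
      rw [not_or] at h'
      have p' := hπF F' g1' (d'.1 h'.1).1 (d'.1 h'.1).2 h'.1 h'.2
      rw [he] at d
      rcases d.2 with e | e
      · exact absurd p'.2.1 (mem_sdiff.1 e).2
      · exact absurd p'.2.2.1 (mem_sdiff.1 e).2
    · rw [hφ2 F h, hφ1 F' h'] at he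
      rw [not_or] at h
      have p := hπF F g1 (d.1 h.1).1 (d.1 h.1).2 h.1 h.2
      rw [← he] at d'
      rcases d'.2 with e | e
      · exact absurd p.2.1 (mem_sdiff.1 e).2
      · exact absurd p.2.2.1 (mem_sdiff.1 e).2
    · rw [hφ2 F h, hφ2 F' h'] at he
      rw [not_or] at h h'
      have a := hπF F g1 (d.1 h.1).1 (d.1 h.1).2 h.1 h.2
      have a' := hπF F' g1' (d'.1 h'.1).1 (d'.1 h'.1).2 h'.1 h'.2
      apply π.injective
      have h1 := congrArg (fun S => g \ S) he
      simp only [sdiff_sdiff_right_self] at h1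
      rwa [inf_eq_right.2 a.1, inf_eq_right.2 a'.1] at h1
  · intro F hF hFH F' hF' hFH' hne
    have d := hdom F hFH
    have d' := hdom F' hFH'
    have g1 := hdomg F hF
    have g1' := hdomg F' hF'
    by_cases h : x ∈ F ∨ w ∈ F <;> by_cases h' : x ∈ F' ∨ w ∈ F'
    · rwa [hφ1 F h, hφ1 F' h']
    · rw [hφ1 F h, hφ2 F' h']
      rw [not_or] at h'
      have := hπF F' g1' (d'.1 h'.1).1 (d'.1 h'.1).2 h'.1 h'.2
      rcases h with h | h
      · exact ⟨x, by simp [h, hx, this]⟩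
      · exact ⟨w, by simp [h, hw, this]⟩
    · rw [hφ2 F h, hφ1 F' h']
      rw [not_or] at h
      have := hπF F g1 (d.1 h.1).1 (d.1 h.1).2 h.1 h.2
      rcases h' with h' | h'
      · exact ⟨x, by simp [h', hx, this]⟩
      · exact ⟨w, by simp [h', hw, this]⟩
    · rw [hφ2 F h, hφ2 F' h']
      rw [not_or] at h h'
      have a := hπF F g1 (d.1 h.1).1 (d.1 h.1).2 h.1 h.2
      have a' := hπF F' g1' (d'.1 h'.1).1 (d'.1 h'.1).2 h'.1 h'.2
      exact ⟨x, by simp [hx, a, a']⟩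

/-- The pairs through the point `1`. -/
def starPairs (n : ℕ) : Finset (Finset ℕ) := (layerEQ n 2).filter fun A => 1 ∈ A

theorem starPairs_subset (n : ℕ) : starPairs n ⊆ layerEQ n 2 := filter_subset _ _

theorem card_starPairs {n : ℕ} (hn : 1 ≤ n) : (starPairs n).card = n - 1 := by
  have h1 : 1 ∈ groundSet n := by simp [groundSet, hn]
  have : starPairs n = ((groundSet n).erase 1).image fun x => {1, x} := by
    ext A
    constructor
    · intro hA
      obtain ⟨hA, h1A⟩ := mem_filter.1 hA
      obtain ⟨x, hx, hxc, rfl⟩ := exists_eq_pair_of_mem hA h1A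
      exact mem_image.2 ⟨x, mem_erase.2 ⟨hxc, hx⟩, rfl⟩
    · intro hA
      obtain ⟨x, hx, rfl⟩ := mem_image.1 hA
      obtain ⟨hx1, hxg⟩ := mem_erase.1 hx
      exact mem_filter.2 ⟨mem_layerEQ.2 ⟨insert_subset h1 (singleton_subset_iff.2 hxg),
        card_pair hx1.symm⟩, by simp⟩
  rw [this, card_image_of_injOn (injOn_pair _ _), card_erase_of_mem h1, card_groundSet]

theorem card_famsThrough_le_starPairs (s : ℕ) {n : ℕ} (hn : 5 ≤ n) {H H' : Finset (Finset ℕ)}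
    (hH : H ⊆ layerEQ n 2) (hH' : H' ⊆ starPairs n) (hcard : H.card = H'.card) :
    (famsThrough s (layerGE n 3) H).card ≤ (famsThrough s (layerGE n 3) H').card := by
  have h1g : 1 ∈ groundSet n := by simp [groundSet]; omega
  have hH'2 := hH'.trans (starPairs_subset n)
  have h1H' : ∀ A ∈ H', 1 ∈ A := fun A hA => (mem_filter.1 (hH' hA)).2
  by_cases hmeet : ∀ A ∈ H, ∀ B ∈ H, (A ∩ B).Nonempty
  · by_cases hc : ∃ c ∈ groundSet n, ∀ A ∈ H, c ∈ A
    · obtain ⟨c, hc, hcH⟩ := hc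
      exact card_famsThrough_le_of_star s hc h1g hH hH'2 hcH h1H' hcard
    · obtain ⟨x, hx, y, hy, z, hz, hxy, hxz, hyz, rfl⟩ :=
        eq_triangle_of_intersecting hH (by omega) hmeet hc
      obtain ⟨w, hw⟩ : (groundSet n \ {x, y, z}).Nonempty := by
        rw [← card_pos]
        have h1 := le_card_sdiff {x, y, z} (groundSet n)
        have h2 := card_le_three (a := x) (b := y) (c := z)
        rw [card_groundSet] at h1
        omega
      simp only [mem_sdiff, mem_insert, mem_singleton, not_or] at hw
      obtain ⟨hw, hwx, hwy, hwz⟩ := hw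
      have notin : ∀ {a b c d : ℕ}, a ≠ c → a ≠ d → ({a, b} : Finset ℕ) ≠ {c, d} := by
        intro a b c d h1 h2 h
        have : a ∈ ({c, d} : Finset ℕ) := by rw [← h]; simp
        simp [h1, h2] at this
      have notin' : ∀ {a b c d : ℕ}, b ≠ c → b ≠ d → ({a, b} : Finset ℕ) ≠ {c, d} := by
        intro a b c d h1 h2 h
        have : b ∈ ({c, d} : Finset ℕ) := by rw [← h]; simp
        simp [h1, h2] at this
      refine (card_famsThrough_triangle_le s hn hx hy hz hw hxy hxz hyz hwx hwy hwz).trans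
        (card_famsThrough_le_of_star s hx h1g ?_ hH'2 (by simp) h1H' ?_)
      · intro A hA
        simp only [mem_insert, mem_singleton] at hA
        rcases hA with rfl | rfl | rfl
        · exact hH (by simp)
        · exact hH (by simp)
        · exact mem_layerEQ.2 ⟨insert_subset hx (singleton_subset_iff.2 hw), card_pair (Ne.symm hwx)⟩
      · rw [← hcard]
        exact (card_eq_three.2 ⟨{x, y}, {x, z}, {x, w}, notin' hxy.symm hyz,
          notin' hxy.symm (Ne.symm hwy), notin' hxz.symm (Ne.symm hwz), rfl⟩).trans
          (card_eq_three.2 ⟨{x, y}, {x, z}, {y, z}, notin' hxy.symm hyz, notin hxy hxz,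
          notin hxy hxz, rfl⟩).symm
  · push Not at hmeet
    obtain ⟨A, hA, B, hB, hAB⟩ := hmeet
    rw [card_famsThrough_eq_zero_of_disjoint s hA hB (by simpa using hAB)]
    exact Nat.zero_le _

theorem card_interFams_lt_star {n s : ℕ} (hn : 5 ≤ n) (hs1 : 2 ≤ s) (hs2 : s ≤ 2 ^ (n - 1))
    {G : Finset (Finset ℕ)} (hG : G ⊆ layerEQ n 2) (hGc : G.card = n - 1)
    (hc : ¬ ∃ c ∈ groundSet n, ∀ A ∈ G, c ∈ A) :
    (interFams s (layerGE n 3 ∪ G)).card < (interFams s (layerGE n 3 ∪ starPairs n)).card := by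
  obtain ⟨σ, hσ, -⟩ := exists_perm_image_eq (s := G) (t := starPairs n)
    (by rw [hGc, card_starPairs (by omega)])
  have hσs : ∀ H ⊆ G, H.image σ ⊆ starPairs n := fun H hH => hσ ▸ image_subset_image hH
  have hσc : ∀ H : Finset (Finset ℕ), H.card = (H.image σ).card := fun H =>
    (card_image_of_injective _ σ.injective).symm
  rw [card_interFams_eq_sum_famsThrough s (disjoint_layerGE_three hG),
    card_interFams_eq_sum_famsThrough s (disjoint_layerGE_three (starPairs_subset n)),
    ← hσ, powerset_image, sum_image (image_injective σ.injective).injOn]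
  refine sum_lt_sum (fun H hH => ?_) ?_
  · rw [mem_powerset] at hH
    exact card_famsThrough_le_starPairs s hn (hH.trans hG) (hσs H hH) (hσc H)
  · obtain ⟨A, hA, B, hB, hAB⟩ : ∃ A ∈ G, ∃ B ∈ G, ¬ (A ∩ B).Nonempty := by
      by_contra hcon
      push Not at hcon
      obtain ⟨x, -, y, -, z, -, -, -, -, rfl⟩ := eq_triangle_of_intersecting hG (by omega)
        (fun A hA B hB => nonempty_iff_ne_empty.2 fun h => by simpa [h] using hcon A hA B hB) hc
      have := card_le_three (a := ({x, y} : Finset ℕ)) (b := {x, z}) (c := {y, z})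
      omega
    have hABG : ({A, B} : Finset (Finset ℕ)) ⊆ G := insert_subset hA (singleton_subset_iff.2 hB)
    refine ⟨{A, B}, mem_powerset.2 hABG, ?_⟩
    rw [card_famsThrough_eq_zero_of_disjoint s (A := A) (B := B) (by simp) (by simp) hAB]
    rw [card_pos]
    have hs := hσs _ hABG
    have h1 : σ A ∈ starPairs n := hs (mem_image_of_mem _ (by simp))
    have h2 : σ B ∈ starPairs n := hs (mem_image_of_mem _ (by simp))
    have g1 := mem_layerEQ.1 (starPairs_subset n h1)
    have g2 := mem_layerEQ.1 (starPairs_subset n h2)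
    obtain ⟨𝓔, hc, hA𝓔, hB𝓔, hmeet, hmem⟩ := exists_interFam_of_pair (by omega) hs1 hs2 g1.1 g2.1
      ⟨1, mem_inter.2 ⟨(mem_filter.1 h1).2, (mem_filter.1 h2).2⟩⟩
    refine ⟨𝓔, mem_filter.2 ⟨mem_interFams.2 ⟨fun Z hZ => ?_, hc, hmeet⟩, ?_⟩⟩
    · obtain ⟨hZg, hZ⟩ := hmem Z hZ
      have key : ∀ P ∈ ({σ A, σ B} : Finset (Finset ℕ)), P.card = 2 → P ⊆ Z →
          Z ∈ layerGE n 3 ∪ ({A, B} : Finset (Finset ℕ)).image σ := by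
        intro P hP hP2 hPZ
        by_cases h3 : 3 ≤ Z.card
        · exact mem_union_left _ (mem_layerGE.2 ⟨hZg, h3⟩)
        · rw [← eq_of_subset_of_card_le hPZ (by omega)]
          exact mem_union_right _ (by simpa [image_insert] using hP)
      rcases hZ with hZ | hZ | hZ
      · exact key _ (by simp) g1.2 hZ
      · exact key _ (by simp) g2.2 hZ
      · exact mem_union_left _ (mem_layerGE.2 ⟨hZg, by omega⟩)
    · intro P hP
      simp only [image_insert, image_singleton, mem_insert, mem_singleton] at hP
      rcases hP with rfl | rfl <;> assumption

theorem replace_mem_interFams {t : ℕ} {𝓗 𝓗' 𝓕 𝓟 𝓠 : Finset (Finset ℕ)} (h𝓕 : 𝓕 ∈ interFams t 𝓗)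
    (h𝓟 : 𝓟 ⊆ 𝓕) (h𝓠 : Disjoint 𝓕 𝓠) (hc : 𝓟.card = 𝓠.card)
    (hsub : ∀ F ∈ 𝓕 \ 𝓟, F ∈ 𝓗') (hsub' : 𝓠 ⊆ 𝓗')
    (h1 : ∀ F ∈ 𝓕 \ 𝓟, ∀ Q ∈ 𝓠, (F ∩ Q).Nonempty)
    (h2 : ∀ Q ∈ 𝓠, ∀ Q' ∈ 𝓠, (Q ∩ Q').Nonempty) :
    𝓕 \ 𝓟 ∪ 𝓠 ∈ interFams t 𝓗' := by
  obtain ⟨-, hc𝓕, hmeet⟩ := mem_interFams.1 h𝓕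
  refine mem_interFams.2 ⟨union_subset hsub hsub', ?_, fun B hB B' hB' => ?_⟩
  · rw [card_union_of_disjoint (h𝓠.mono_left sdiff_subset), ← hc, card_sdiff_add_card_eq_card h𝓟,
      hc𝓕]
  · rcases mem_union.1 hB with hB | hB <;> rcases mem_union.1 hB' with hB' | hB'
    · exact hmeet B (mem_sdiff.1 hB).1 B' (mem_sdiff.1 hB').1
    · exact h1 B hB B' hB'
    · rw [inter_comm]; exact h1 B' hB' B hB
    · exact h2 B hB B' hB'

theorem replace_inj {𝓕 𝓕' 𝓟 𝓠 : Finset (Finset ℕ)} (h𝓟 : 𝓟 ⊆ 𝓕) (h𝓟' : 𝓟 ⊆ 𝓕')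
    (h𝓠 : Disjoint 𝓕 𝓠) (h𝓠' : Disjoint 𝓕' 𝓠) (h : 𝓕 \ 𝓟 ∪ 𝓠 = 𝓕' \ 𝓟 ∪ 𝓠) : 𝓕 = 𝓕' := by
  have key : ∀ {𝓕 : Finset (Finset ℕ)}, 𝓟 ⊆ 𝓕 → Disjoint 𝓕 𝓠 → (𝓕 \ 𝓟 ∪ 𝓠) \ 𝓠 ∪ 𝓟 = 𝓕 := by
    intro 𝓕 h1 h2
    rw [union_sdiff_cancel_right (h2.mono_left sdiff_subset), sdiff_union_of_subset h1]
  rw [← key h𝓟 h𝓠, h, key h𝓟' h𝓠']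

theorem inter_sdiff_nonempty_of_not_subset {g F E : Finset ℕ} (hF : F ⊆ g) (h : ¬ F ⊆ E) :
    (F ∩ (g \ E)).Nonempty := by
  obtain ⟨x, hx, hxE⟩ := not_subset.1 h
  exact ⟨x, mem_inter.2 ⟨hx, mem_sdiff.2 ⟨hF hx, hxE⟩⟩⟩

/-- A pair `(E, L)` for which trading `D` against the complement of `E` keeps at least half of the
intersecting families through `D`. -/
structure Gadget (g : Finset ℕ) (𝓗 : Finset (Finset ℕ)) (D E L : Finset ℕ) : Prop where
  compl_notMem : g \ E ∉ 𝓗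
  eq_of_subset : ∀ F ∈ 𝓗, F ⊆ L → F = L
  of_subset : ∀ F ∈ 𝓗, F ⊆ E → F = E ∨ F = L ∨ Disjoint F D
  compl_mem : g \ L ∈ 𝓗
  nonempty_compl : (g \ L).Nonempty
  meet_compl : ((g \ E) ∩ (g \ D)).Nonempty
  ne_left : D ≠ E
  ne_right : D ≠ L

theorem Gadget.card_le {g : Finset ℕ} {𝓗 : Finset (Finset ℕ)} {D E L : Finset ℕ} (t : ℕ)
    (hG : Gadget g 𝓗 D E L) (h𝓗 : ∀ F ∈ 𝓗, F ⊆ g) (hD : ∀ F ∈ 𝓗, F ⊆ D → F = D)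
    (hD' : g \ D ∈ 𝓗) :
    ((interFams t 𝓗).filter fun 𝓕 => D ∈ 𝓕).card ≤
      2 * ((interFams t (insert (g \ E) (𝓗.erase D))).filter fun 𝓕 => g \ E ∈ 𝓕).card := by
  set 𝓓 := (interFams t 𝓗).filter fun 𝓕 => D ∈ 𝓕 with h𝓓
  have hcompl : ∀ F P : Finset ℕ, F ∩ (g \ P) = ∅ → F ⊆ g → F ⊆ P := fun F P h hF => by
    by_contra hn
    exact (inter_sdiff_nonempty_of_not_subset hF hn).ne_empty h
  have hself : ∀ P : Finset ℕ, P ∩ (g \ P) = ∅ := fun P => by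
    ext x; simp
  have hnotboth : ∀ 𝓕 ∈ interFams t 𝓗, ∀ P ∈ 𝓕, g \ P ∉ 𝓕 := fun 𝓕 h𝓕 P hP hP' =>
    ((mem_interFams.1 h𝓕).2.2 P hP _ hP').ne_empty (hself P)
  -- the families avoiding `L` are at least half
  have hhalf : (𝓓.filter fun 𝓕 => L ∈ 𝓕).card ≤ (𝓓.filter fun 𝓕 => L ∉ 𝓕).card := by
    refine card_le_card_of_injOn (fun 𝓕 => 𝓕 \ {L} ∪ {g \ L}) ?_ ?_
    · intro 𝓕 h
      obtain ⟨h, hL⟩ := mem_filter.1 h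
      obtain ⟨h, hDm⟩ := mem_filter.1 h
      obtain ⟨h1, -, -⟩ := mem_interFams.1 h
      have hLg : L ⊆ g := h𝓗 L (h1 hL)
      refine mem_filter.2 ⟨mem_filter.2 ⟨replace_mem_interFams h (by simpa using hL)
        (by simpa using hnotboth 𝓕 h L hL) (by simp) (fun F hF => h1 (mem_sdiff.1 hF).1)
        (by simpa using hG.compl_mem) ?_ ?_, ?_⟩, ?_⟩
      · intro F hF Q hQ
        rw [mem_singleton.1 hQ]
        obtain ⟨hF, hFL⟩ := mem_sdiff.1 hF
        exact inter_sdiff_nonempty_of_not_subset (h𝓗 F (h1 hF)) fun hs =>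
          hFL (mem_singleton.2 (hG.eq_of_subset F (h1 hF) hs))
      · simpa using hG.nonempty_compl
      · simp [hDm, hG.ne_right]
      · have : L ≠ g \ L := fun e => hnotboth 𝓕 h L hL (e ▸ hL)
        simpa using this
    · intro 𝓕 h 𝓕' h' e
      obtain ⟨h, hL⟩ := mem_filter.1 h
      obtain ⟨h', hL'⟩ := mem_filter.1 h'
      exact replace_inj (by simpa using hL) (by simpa using hL')
        (by simpa using hnotboth 𝓕 (mem_filter.1 h).1 L hL)
        (by simpa using hnotboth 𝓕' (mem_filter.1 h').1 L hL') e
  have hmain : (𝓓.filter fun 𝓕 => L ∉ 𝓕).card ≤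
      ((interFams t (insert (g \ E) (𝓗.erase D))).filter fun 𝓕 => g \ E ∈ 𝓕).card := by
    have hXD : g \ E ≠ g \ D := fun h => hG.compl_notMem (h ▸ hD')
    have hdis : ∀ 𝓕 ∈ interFams t 𝓗, Disjoint 𝓕 {g \ E} := fun 𝓕 h => by
      simpa using fun hm => hG.compl_notMem ((mem_interFams.1 h).1 hm)
    have hdis2 : ∀ 𝓕 ∈ interFams t 𝓗, D ∈ 𝓕 → Disjoint 𝓕 {g \ E, g \ D} := fun 𝓕 h hDm => by
      rw [disjoint_insert_right]
      exact ⟨fun hm => hG.compl_notMem ((mem_interFams.1 h).1 hm),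
        by simpa using hnotboth 𝓕 h D hDm⟩
    have hc2 : ({D, E} : Finset (Finset ℕ)).card = ({g \ E, g \ D} : Finset (Finset ℕ)).card := by
      rw [card_pair hG.ne_left, card_pair hXD]
    have hmeetX : ∀ 𝓕 ∈ interFams t 𝓗, D ∈ 𝓕 → L ∉ 𝓕 → ∀ F ∈ 𝓕, F ≠ E →
        (F ∩ (g \ E)).Nonempty := by
      intro 𝓕 h hDm hL F hF hFE
      obtain ⟨h1, -, h3⟩ := mem_interFams.1 h
      refine inter_sdiff_nonempty_of_not_subset (h𝓗 F (h1 hF)) fun hs => ?_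
      rcases hG.of_subset F (h1 hF) hs with rfl | rfl | hd
      · exact hFE rfl
      · exact hL hF
      · exact (h3 F hF D hDm).ne_empty (disjoint_iff_inter_eq_empty.1 hd)
    have hXne : (g \ E).Nonempty := hG.meet_compl.mono inter_subset_left
    have hDne : (g \ D).Nonempty := hG.meet_compl.mono inter_subset_right
    classical
    refine card_le_card_of_injOn (fun 𝓕 => if E ∈ 𝓕 then 𝓕 \ {D, E} ∪ {g \ E, g \ D}
      else 𝓕 \ {D} ∪ {g \ E}) ?_ ?_
    · intro 𝓕 h
      obtain ⟨h, hL⟩ := mem_filter.1 h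
      obtain ⟨h, hDm⟩ := mem_filter.1 h
      obtain ⟨h1, -, h3⟩ := mem_interFams.1 h
      by_cases hE : E ∈ 𝓕
      · simp only [if_pos hE]
        refine mem_coe.2 (mem_filter.2 ⟨replace_mem_interFams h ?_ (hdis2 𝓕 h hDm) hc2 ?_ ?_ ?_ ?_,
          by simp⟩)
        · exact insert_subset hDm (singleton_subset_iff.2 hE)
        · intro F hF
          obtain ⟨hF, hF'⟩ := mem_sdiff.1 hF
          simp only [mem_insert, mem_singleton, not_or] at hF'
          exact mem_insert_of_mem (mem_erase.2 ⟨hF'.1, h1 hF⟩)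
        · refine insert_subset (mem_insert_self _ _) (singleton_subset_iff.2 ?_)
          exact mem_insert_of_mem (mem_erase.2 ⟨fun e => hnotboth 𝓕 h D hDm (e.symm ▸ hDm), hD'⟩)
        · intro F hF Q hQ
          obtain ⟨hF, hF'⟩ := mem_sdiff.1 hF
          simp only [mem_insert, mem_singleton, not_or] at hF' hQ
          rcases hQ with rfl | rfl
          · exact hmeetX 𝓕 h hDm hL F hF hF'.2
          · exact inter_sdiff_nonempty_of_not_subset (h𝓗 F (h1 hF)) fun hs =>
              hF'.1 (hD F (h1 hF) hs)
        · intro Q hQ Q' hQ'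
          simp only [mem_insert, mem_singleton] at hQ hQ'
          rcases hQ with rfl | rfl <;> rcases hQ' with rfl | rfl
          · simpa using hXne
          · exact hG.meet_compl
          · rw [inter_comm]; exact hG.meet_compl
          · simpa using hDne
      · simp only [if_neg hE]
        refine mem_coe.2 (mem_filter.2 ⟨replace_mem_interFams h (by simpa using hDm) (hdis 𝓕 h)
          (by simp) ?_ (by simp) ?_ ?_, by simp⟩)
        · intro F hF
          obtain ⟨hF, hF'⟩ := mem_sdiff.1 hF
          exact mem_insert_of_mem (mem_erase.2 ⟨by simpa using hF', h1 hF⟩)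
        · intro F hF Q hQ
          rw [mem_singleton.1 hQ]
          have hF := (mem_sdiff.1 hF).1
          exact hmeetX 𝓕 h hDm hL F hF fun e => hE (e ▸ hF)
        · simpa using hXne
    · intro 𝓕 h 𝓕' h' e
      have h := (mem_filter.1 h).1
      have h' := (mem_filter.1 h').1
      obtain ⟨h, hDm⟩ := mem_filter.1 h
      obtain ⟨h', hDm'⟩ := mem_filter.1 h'
      have hdet : ∀ 𝓕 ∈ interFams t 𝓗, D ∈ 𝓕 → g \ D ∉ 𝓕 \ {D} ∪ {g \ E} := by
        intro 𝓕 h hDm hm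
        rcases mem_union.1 hm with hm | hm
        · exact hnotboth 𝓕 h D hDm (mem_sdiff.1 hm).1
        · exact hXD (mem_singleton.1 hm).symm
      by_cases hE : E ∈ 𝓕 <;> by_cases hE' : E ∈ 𝓕'
      · simp only [if_pos hE, if_pos hE'] at e
        exact replace_inj (insert_subset hDm (singleton_subset_iff.2 hE))
          (insert_subset hDm' (singleton_subset_iff.2 hE')) (hdis2 𝓕 h hDm) (hdis2 𝓕' h' hDm') e
      · simp only [if_pos hE, if_neg hE'] at e
        exact absurd (e ▸ (by simp : g \ D ∈ 𝓕 \ {D, E} ∪ {g \ E, g \ D})) (hdet 𝓕' h' hDm')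
      · simp only [if_neg hE, if_pos hE'] at e
        exact absurd (e.symm ▸ (by simp : g \ D ∈ 𝓕' \ {D, E} ∪ {g \ E, g \ D})) (hdet 𝓕 h hDm)
      · simp only [if_neg hE, if_neg hE'] at e
        exact replace_inj (by simpa using hDm) (by simpa using hDm') (hdis 𝓕 h) (hdis 𝓕' h') e
  have := card_filter_add_card_filter_not (s := 𝓓) fun 𝓕 => L ∈ 𝓕
  omega

/-- Two gadgets pay for the removal of `D`. -/
theorem card_interFams_le_of_gadgets {g : Finset ℕ} {𝓗 : Finset (Finset ℕ)}
    {D E₁ L₁ E₂ L₂ : Finset ℕ} (t : ℕ) (hG₁ : Gadget g 𝓗 D E₁ L₁) (hG₂ : Gadget g 𝓗 D E₂ L₂)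
    (hne : g \ E₁ ≠ g \ E₂) (h𝓗 : ∀ F ∈ 𝓗, F ⊆ g) (hD : ∀ F ∈ 𝓗, F ⊆ D → F = D)
    (hD' : g \ D ∈ 𝓗) :
    (interFams t 𝓗).card ≤
      (interFams t (insert (g \ E₁) (insert (g \ E₂) (𝓗.erase D)))).card := by
  have c1 := hG₁.card_le t h𝓗 hD hD'
  have c2 := hG₂.card_le t h𝓗 hD hD'
  have hsplit := card_filter_add_card_filter_not (s := interFams t 𝓗) fun 𝓕 => D ∈ 𝓕
  set 𝓝 := insert (g \ E₁) (insert (g \ E₂) (𝓗.erase D)) with h𝓝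
  set P₁ := (interFams t (insert (g \ E₁) (𝓗.erase D))).filter fun 𝓕 => g \ E₁ ∈ 𝓕
  set P₂ := (interFams t (insert (g \ E₂) (𝓗.erase D))).filter fun 𝓕 => g \ E₂ ∈ 𝓕
  set P₀ := (interFams t 𝓗).filter fun 𝓕 => D ∉ 𝓕
  have hX₀ : ∀ {E}, g \ E ∉ 𝓗 → ∀ 𝓕 ∈ P₀, g \ E ∉ 𝓕 := fun hE 𝓕 h hm =>
    hE ((mem_interFams.1 (mem_filter.1 h).1).1 hm)
  have hX₁ : ∀ 𝓕 ∈ P₁, g \ E₂ ∉ 𝓕 := fun 𝓕 h hm => by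
    rcases mem_insert.1 ((mem_interFams.1 (mem_filter.1 h).1).1 hm) with e | e
    · exact hne e.symm
    · exact hG₂.compl_notMem (mem_of_mem_erase e)
  have d01 : Disjoint P₀ P₁ := disjoint_left.2 fun 𝓕 h h' =>
    hX₀ hG₁.compl_notMem 𝓕 h (mem_filter.1 h').2
  have d02 : Disjoint P₀ P₂ := disjoint_left.2 fun 𝓕 h h' =>
    hX₀ hG₂.compl_notMem 𝓕 h (mem_filter.1 h').2
  have d12 : Disjoint P₁ P₂ := disjoint_left.2 fun 𝓕 h h' => hX₁ 𝓕 h (mem_filter.1 h').2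
  have hsub : P₀ ∪ P₁ ∪ P₂ ⊆ interFams t 𝓝 := by
    have mono : ∀ {𝓚 : Finset (Finset ℕ)}, 𝓚 ⊆ 𝓝 → ∀ 𝓕 ∈ interFams t 𝓚, 𝓕 ∈ interFams t 𝓝 :=
      fun h 𝓕 h𝓕 => by
        obtain ⟨a, b, c⟩ := mem_interFams.1 h𝓕
        exact mem_interFams.2 ⟨a.trans h, b, c⟩
    intro 𝓕 h
    rcases mem_union.1 h with h | h
    · rcases mem_union.1 h with h | h
      · obtain ⟨h, hDn⟩ := mem_filter.1 h
        obtain ⟨a, b, c⟩ := mem_interFams.1 h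
        refine mem_interFams.2 ⟨fun F hF => ?_, b, c⟩
        exact mem_insert_of_mem (mem_insert_of_mem (mem_erase.2 ⟨fun e => hDn (e ▸ hF), a hF⟩))
      · exact mono (insert_subset_insert _ (subset_insert _ _)) 𝓕 (mem_filter.1 h).1
    · exact mono (subset_insert _ _) 𝓕 (mem_filter.1 h).1
  have := card_le_card hsub
  rw [card_union_of_disjoint (disjoint_union_left.2 ⟨d02, d12⟩), card_union_of_disjoint d01] at this
  omega

/-- A triple `{b₁, b₂, b₃}` in `g`, with the rest of `g` split into `K` and `N`, and `M ⊆ N`. -/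
structure Config (g : Finset ℕ) (b₁ b₂ b₃ : ℕ) (K N M : Finset ℕ) : Prop where
  card_ge : 21 ≤ g.card
  mem₁ : b₁ ∈ g
  mem₂ : b₂ ∈ g
  mem₃ : b₃ ∈ g
  ne₁₂ : b₁ ≠ b₂
  ne₁₃ : b₁ ≠ b₃
  ne₂₃ : b₂ ≠ b₃
  subK : K ⊆ g
  subN : N ⊆ g
  disj : Disjoint K N
  notK : ∀ x ∈ K, x ≠ b₁ ∧ x ≠ b₂ ∧ x ≠ b₃
  notN : ∀ x ∈ N, x ≠ b₁ ∧ x ≠ b₂ ∧ x ≠ b₃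
  cover : ∀ x ∈ g, x = b₁ ∨ x = b₂ ∨ x = b₃ ∨ x ∈ K ∨ x ∈ N
  subM : M ⊆ N
  cardN : N.card = M.card + 2

theorem Config.swap {g K N M : Finset ℕ} {b₁ b₂ b₃ : ℕ} (h : Config g b₁ b₂ b₃ K N M) :
    Config g b₂ b₁ b₃ K N M where
  card_ge := h.card_ge
  mem₁ := h.mem₂
  mem₂ := h.mem₁
  mem₃ := h.mem₃
  ne₁₂ := h.ne₁₂.symm
  ne₁₃ := h.ne₂₃
  ne₂₃ := h.ne₁₃
  subK := h.subK
  subN := h.subN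
  disj := h.disj
  notK := fun x hx => ⟨(h.notK x hx).2.1, (h.notK x hx).1, (h.notK x hx).2.2⟩
  notN := fun x hx => ⟨(h.notN x hx).2.1, (h.notN x hx).1, (h.notN x hx).2.2⟩
  cover := fun x hx => by have := h.cover x hx; tauto
  subM := h.subM
  cardN := h.cardN

theorem Config.card_eq {g K N M : Finset ℕ} {b₁ b₂ b₃ : ℕ} (h : Config g b₁ b₂ b₃ K N M) :
    g.card = K.card + N.card + 3 := by
  have e : g = K ∪ N ∪ {b₁, b₂, b₃} := by
    ext x
    simp only [mem_union, mem_insert, mem_singleton]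
    constructor
    · intro hx
      have := h.cover x hx
      tauto
    · rintro ((hx | hx) | rfl | rfl | rfl)
      · exact h.subK hx
      · exact h.subN hx
      · exact h.mem₁
      · exact h.mem₂
      · exact h.mem₃
  have hd : Disjoint (K ∪ N) {b₁, b₂, b₃} := by
    rw [disjoint_left]
    intro x hx
    simp only [mem_insert, mem_singleton, not_or]
    rcases mem_union.1 hx with hx | hx
    · exact h.notK x hx
    · exact h.notN x hx
  have h3 : ({b₁, b₂, b₃} : Finset ℕ).card = 3 :=
    card_eq_three.2 ⟨b₁, b₂, b₃, h.ne₁₂, h.ne₁₃, h.ne₂₃, rfl⟩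
  rw [e, card_union_of_disjoint hd, card_union_of_disjoint h.disj, h3]

/-- What the small members of a family have to look like for gadgets to be available. -/
structure Tame (g : Finset ℕ) (b₁ b₂ : ℕ) (K N : Finset ℕ) (𝓗 : Finset (Finset ℕ)) : Prop where
  sub : ∀ F ∈ 𝓗, F ⊆ g
  meet : ∀ F ∈ 𝓗, F.card ≤ 4 → b₁ ∈ F ∨ b₂ ∈ F
  small : ∀ F ∈ 𝓗, F.card ≤ 4 → 3 ≤ F.card ∨ ∃ κ ∈ K, F = {b₁, κ} ∨ F = {b₂, κ}
  notTriple : ∀ F ∈ 𝓗, ∀ q ∈ N, F ≠ {b₁, b₂, q}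
  large : ∀ F ⊆ g, 4 ≤ F.card → b₁ ∈ F ∨ b₂ ∈ F → F ∈ 𝓗

theorem Tame.swap {g K N : Finset ℕ} {b₁ b₂ : ℕ} {𝓗 : Finset (Finset ℕ)}
    (h : Tame g b₁ b₂ K N 𝓗) : Tame g b₂ b₁ K N 𝓗 where
  sub := h.sub
  meet := fun F hF hc => (h.meet F hF hc).symm
  small := fun F hF hc => (h.small F hF hc).imp_right fun ⟨κ, hκ, h⟩ => ⟨κ, hκ, h.symm⟩
  notTriple := fun F hF q hq => by rw [insert_comm]; exact h.notTriple F hF q hq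
  large := fun F hF hc h' => h.large F hF hc h'.symm

/-- The sets `Q` giving gadgets for `{b₁, b₃, w}`. -/
def gadgetPool (K N : Finset ℕ) (w : ℕ) : Finset (Finset ℕ) :=
  (K.image fun κ => {κ}) ∪ (N.erase w).powersetCard 2

theorem mem_gadgetPool {K N Q : Finset ℕ} {w : ℕ} :
    Q ∈ gadgetPool K N w ↔ (∃ κ ∈ K, Q = {κ}) ∨ (Q ⊆ N ∧ w ∉ Q ∧ Q.card = 2) := by
  simp only [gadgetPool, mem_union, mem_image, mem_powersetCard, subset_erase, eq_comm (a := Q),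
    and_assoc]

theorem Config.card_gadgetPool {g K N M : Finset ℕ} {b₁ b₂ b₃ : ℕ}
    (h : Config g b₁ b₂ b₃ K N M) {w : ℕ} (hw : w ∈ M) :
    4 * M.card ≤ (gadgetPool K N w).card := by
  have hd : Disjoint (K.image fun κ => ({κ} : Finset ℕ)) ((N.erase w).powersetCard 2) := by
    refine disjoint_left.2 fun Q hQ hQ' => ?_
    obtain ⟨κ, -, rfl⟩ := mem_image.1 hQ
    simpa using (mem_powersetCard.1 hQ').2
  rw [gadgetPool, card_union_of_disjoint hd, card_image_of_injective _ (singleton_injective),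
    card_powersetCard, card_erase_of_mem (h.subM hw), h.cardN]
  have h1 := h.card_eq
  have h2 := h.card_ge
  have h3 := h.cardN
  have h4 : M.card + 2 - 1 = M.card + 1 := rfl
  rw [h4, Nat.choose_two_right, Nat.add_sub_cancel]
  have h5 : 2 * ((M.card + 1) * M.card / 2) = (M.card + 1) * M.card :=
    Nat.mul_div_cancel' (Nat.even_mul_pred_self (M.card + 1)).two_dvd
  by_cases hm : M.card ≤ 7
  · interval_cases M.card <;> omega
  · nlinarith

theorem Config.disjoint_of_mem_gadgetPool {g K N M : Finset ℕ} {b₁ b₂ b₃ w : ℕ}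
    (h : Config g b₁ b₂ b₃ K N M) (hw : w ∈ M) {Q : Finset ℕ} (hQ : Q ∈ gadgetPool K N w) :
    Q ⊆ g ∧ b₁ ∉ Q ∧ b₂ ∉ Q ∧ b₃ ∉ Q ∧ w ∉ Q ∧ Q.card ≤ 2 := by
  rcases mem_gadgetPool.1 hQ with ⟨κ, hκ, rfl⟩ | ⟨hQN, hwQ, hQ2⟩
  · obtain ⟨h1, h2, h3⟩ := h.notK κ hκ
    have hwκ : w ≠ κ := fun e => disjoint_left.1 h.disj hκ (e ▸ h.subM hw)
    simp [h.subK hκ, h1.symm, h2.symm, h3.symm, hwκ]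
  · exact ⟨hQN.trans h.subN, fun hm => (h.notN _ (hQN hm)).1 rfl,
      fun hm => (h.notN _ (hQN hm)).2.1 rfl, fun hm => (h.notN _ (hQN hm)).2.2 rfl, hwQ, hQ2.le⟩

theorem Config.gadget {g K N M : Finset ℕ} {b₁ b₂ b₃ w : ℕ} (h : Config g b₁ b₂ b₃ K N M)
    {𝓗 : Finset (Finset ℕ)} (h𝓗 : Tame g b₁ b₂ K N 𝓗) (hw : w ∈ M) {Q : Finset ℕ}
    (hQ : Q ∈ gadgetPool K N w) (hnot : g \ insert b₁ (insert b₂ Q) ∉ 𝓗) :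
    Gadget g 𝓗 {b₁, b₃, w} (insert b₁ (insert b₂ Q)) (insert b₁ Q) := by
  obtain ⟨hQg, h1Q, h2Q, h3Q, hwQ, hQc⟩ := h.disjoint_of_mem_gadgetPool hw hQ
  have hg := h.card_ge
  have hwN := h.notN w (h.subM hw)
  have hLc : (insert b₁ Q).card ≤ 3 := (card_insert_le _ _).trans (by omega)
  have hEc : (insert b₁ (insert b₂ Q)).card ≤ 4 :=
    (card_insert_le _ _).trans (by have := card_insert_le b₂ Q; omega)
  have h12 := h.ne₁₂
  have hpair : ∀ κ ∈ K, κ ∈ insert b₁ (insert b₂ Q) → Q = {κ} := by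
    intro κ hκ hm
    have hκb := h.notK κ hκ
    have hκQ : κ ∈ Q := by simpa [hκb.1, hκb.2.1] using hm
    rcases mem_gadgetPool.1 hQ with ⟨κ', hκ', rfl⟩ | ⟨hQN, -, -⟩
    · rw [mem_singleton.1 hκQ]
    · exact absurd (hQN hκQ) (disjoint_left.1 h.disj hκ)
  have hLsub : ∀ F ∈ 𝓗, F ⊆ insert b₁ Q → F = insert b₁ Q := by
    intro F hF hs
    rcases h𝓗.small F hF ((card_le_card hs).trans (by omega)) with h3 | ⟨κ, hκ, hFκ⟩
    · exact eq_of_subset_of_card_le hs (by omega)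
    · have hκF : κ ∈ F := by rcases hFκ with rfl | rfl <;> simp
      have := hpair κ hκ (insert_subset_insert _ (subset_insert _ _) (hs hκF))
      rcases hFκ with rfl | rfl
      · rw [this]
      · have h2 : b₂ ∈ insert b₁ Q := hs (by simp)
        simp [h12.symm, h2Q] at h2
  refine ⟨hnot, hLsub, ?_, ?_, ?_, ?_, ?_, ?_⟩
  · intro F hF hs
    have hF4 := (card_le_card hs).trans hEc
    by_cases h1F : b₁ ∈ F
    · by_cases h2F : b₂ ∈ F
      · left
        rcases mem_gadgetPool.1 hQ with ⟨κ, hκ, rfl⟩ | ⟨hQN, -, hQ2⟩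
        · rcases h𝓗.small F hF hF4 with h3 | ⟨κ', hκ', hFκ⟩
          · exact eq_of_subset_of_card_le hs (card_le_three.trans h3)
          · exfalso
            have hb := h.notK κ' hκ'
            rcases hFκ with rfl | rfl
            · simp [h12.symm, hb.2.1.symm] at h2F
            · simp [h12, hb.1.symm] at h1F
        · have hex : ∀ q ∈ Q, q ∈ F := by
            intro q hq
            by_contra hqF
            have hs' : F ⊆ {b₁, b₂} ∪ Q.erase q := by
              intro x hx
              have := hs hx
              have hxq : x ≠ q := fun e => hqF (e ▸ hx)
              simp only [mem_insert, mem_union, mem_erase, mem_singleton] at this ⊢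
              tauto
            obtain ⟨p, hp⟩ := card_eq_one.1 (by rw [card_erase_of_mem hq, hQ2] :
              (Q.erase q).card = 1)
            have hpN : p ∈ N := hQN (mem_of_mem_erase (hp ▸ mem_singleton_self p))
            rw [hp] at hs'
            have hs'' : F ⊆ {b₁, b₂, p} := fun x hx => by simpa [or_assoc] using hs' hx
            rcases h𝓗.small F hF hF4 with h3 | ⟨κ', hκ', hFκ⟩
            · exact h𝓗.notTriple F hF p hpN
                (eq_of_subset_of_card_le hs'' (card_le_three.trans h3))
            · have hb := h.notK κ' hκ'
              rcases hFκ with rfl | rfl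
              · simp [h12.symm, hb.2.1.symm] at h2F
              · simp [h12, hb.1.symm] at h1F
          exact Subset.antisymm hs (insert_subset h1F (insert_subset h2F hex))
      · right; left
        refine hLsub F hF fun x hx => ?_
        have := hs hx
        have hx2 : x ≠ b₂ := fun e => h2F (e ▸ hx)
        simp only [mem_insert] at this ⊢
        tauto
    · right; right
      refine disjoint_left.2 fun x hx hxD => ?_
      have hxE := hs hx
      simp only [mem_insert, mem_singleton] at hxD hxE
      rcases hxD with rfl | rfl | rfl
      · exact h1F hx
      · rcases hxE with e | e | e
        · exact h.ne₁₃ e.symm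
        · exact h.ne₂₃ e.symm
        · exact h3Q e
      · rcases hxE with e | e | e
        · exact hwN.1 e
        · exact hwN.2.1 e
        · exact hwQ e
  · refine h𝓗.large _ sdiff_subset ?_ (Or.inr ?_)
    · have := le_card_sdiff (insert b₁ Q) g
      omega
    · simp [h.mem₂, h12.symm, h2Q]
  · rw [← card_pos]
    have := le_card_sdiff (insert b₁ Q) g
    omega
  · rw [← card_pos, ← sdiff_union_distrib]
    have := le_card_sdiff (insert b₁ (insert b₂ Q) ∪ {b₁, b₃, w}) g
    have h2 := card_union_le (insert b₁ (insert b₂ Q)) {b₁, b₃, w}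
    have h3 := card_le_three (a := b₁) (b := b₃) (c := w)
    omega
  · intro e
    have : b₃ ∈ insert b₁ (insert b₂ Q) := e ▸ (by simp)
    simp [h.ne₁₃.symm, h.ne₂₃.symm, h3Q] at this
  · intro e
    have : b₃ ∈ insert b₁ Q := e ▸ (by simp)
    simp [h.ne₁₃.symm, h3Q] at this

/-- One removal step: `{b₁, b₃, w}` is traded for two complements. -/
theorem Config.card_interFams_le_step {g K N M : Finset ℕ} {b₁ b₂ b₃ w : ℕ} (t : ℕ)
    (h : Config g b₁ b₂ b₃ K N M) {𝓗 : Finset (Finset ℕ)} (h𝓗 : Tame g b₁ b₂ K N 𝓗)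
    (hw : w ∈ M) {Q₁ Q₂ : Finset ℕ} (hQ₁ : Q₁ ∈ gadgetPool K N w) (hQ₂ : Q₂ ∈ gadgetPool K N w)
    (hne : Q₁ ≠ Q₂) (h1 : g \ insert b₁ (insert b₂ Q₁) ∉ 𝓗)
    (h2 : g \ insert b₁ (insert b₂ Q₂) ∉ 𝓗) :
    (interFams t 𝓗).card ≤ (interFams t (insert (g \ insert b₁ (insert b₂ Q₁))
      (insert (g \ insert b₁ (insert b₂ Q₂)) (𝓗.erase {b₁, b₃, w})))).card := by
  have hwN := h.notN w (h.subM hw)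
  have hg := h.card_ge
  have hD3 : ({b₁, b₃, w} : Finset ℕ).card = 3 :=
    card_eq_three.2 ⟨b₁, b₃, w, h.ne₁₃, hwN.1.symm, hwN.2.2.symm, rfl⟩
  refine card_interFams_le_of_gadgets t (h.gadget h𝓗 hw hQ₁ h1) (h.gadget h𝓗 hw hQ₂ h2) ?_
    h𝓗.sub ?_ ?_
  · intro e
    obtain ⟨hg1, a1, a2, -⟩ := h.disjoint_of_mem_gadgetPool hw hQ₁
    obtain ⟨hg2, c1, c2, -⟩ := h.disjoint_of_mem_gadgetPool hw hQ₂
    apply hne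
    ext x
    have hx := congrArg (fun S => x ∈ S) e
    simp only [mem_sdiff, mem_insert, eq_iff_iff] at hx
    have u1 := @hg1 x
    have u2 := @hg2 x
    by_cases e1 : x = b₁
    · subst e1; tauto
    by_cases e2 : x = b₂
    · subst e2; tauto
    tauto
  · intro F hF hs
    have hF3 := (card_le_card hs).trans hD3.le
    rcases h𝓗.small F hF (by omega) with h3 | ⟨κ, hκ, hFκ⟩
    · exact eq_of_subset_of_card_le hs (by omega)
    · exfalso
      have hκF : κ ∈ F := by rcases hFκ with rfl | rfl <;> simp
      have hb := h.notK κ hκ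
      have hκD := hs hκF
      simp only [mem_insert, mem_singleton] at hκD
      rcases hκD with e | e | e
      · exact hb.1 e
      · exact hb.2.2 e
      · exact disjoint_left.1 h.disj hκ (e ▸ h.subM hw)
  · refine h𝓗.large _ sdiff_subset ?_ (Or.inr ?_)
    · have := le_card_sdiff {b₁, b₃, w} g
      omega
    · simp [h.mem₂, h.ne₁₂.symm, h.ne₂₃, hwN.2.1.symm]

/-- Subsets of `g` meeting `{b₁, b₂}` that have size at least `3` or are pairs through `K`. -/
def baseFam (g : Finset ℕ) (b₁ b₂ : ℕ) (K : Finset ℕ) : Finset (Finset ℕ) :=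
  g.powerset.filter fun F =>
    (b₁ ∈ F ∨ b₂ ∈ F) ∧ (3 ≤ F.card ∨ ∃ κ ∈ K, F = {b₁, κ} ∨ F = {b₂, κ})

theorem mem_baseFam {g K F : Finset ℕ} {b₁ b₂ : ℕ} :
    F ∈ baseFam g b₁ b₂ K ↔ F ⊆ g ∧ (b₁ ∈ F ∨ b₂ ∈ F) ∧
      (3 ≤ F.card ∨ ∃ κ ∈ K, F = {b₁, κ} ∨ F = {b₂, κ}) := by
  simp only [baseFam, mem_filter, mem_powerset]

theorem Config.card_baseFam {g K N M : Finset ℕ} {b₁ b₂ b₃ : ℕ}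
    (h : Config g b₁ b₂ b₃ K N M) :
    (baseFam g b₁ b₂ K).card + 2 ^ (g.card - 2) ≤ 2 ^ g.card := by
  have hd : Disjoint (baseFam g b₁ b₂ K) (g \ {b₁, b₂}).powerset := by
    refine disjoint_left.2 fun F hF hF' => ?_
    have hs := mem_powerset.1 hF'
    rcases (mem_baseFam.1 hF).2.1 with h1 | h1
    · simpa using hs h1
    · simpa using hs h1
  have hc : (g \ {b₁, b₂}).card = g.card - 2 := by
    rw [card_sdiff_of_subset (insert_subset h.mem₁ (singleton_subset_iff.2 h.mem₂)),
      card_pair h.ne₁₂]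
  rw [← hc, ← card_powerset, ← card_union_of_disjoint hd, ← card_powerset]
  refine card_le_card (union_subset (filter_subset _ _) (powerset_mono.2 sdiff_subset))

/-- Remove the members of `𝓓` and add the complements of `{b₁, b₂} ∪ Q` for `Q ∈ 𝓤`. -/
def tradeFam (g : Finset ℕ) (b₁ b₂ : ℕ) (𝓗 𝓓 𝓤 : Finset (Finset ℕ)) : Finset (Finset ℕ) :=
  (𝓗 \ 𝓓) ∪ 𝓤.image fun Q => g \ insert b₁ (insert b₂ Q)

theorem mem_tradeFam {g F : Finset ℕ} {b₁ b₂ : ℕ} {𝓗 𝓓 𝓤 : Finset (Finset ℕ)} :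
    F ∈ tradeFam g b₁ b₂ 𝓗 𝓓 𝓤 ↔
      (F ∈ 𝓗 ∧ F ∉ 𝓓) ∨ ∃ Q ∈ 𝓤, F = g \ insert b₁ (insert b₂ Q) := by
  simp only [tradeFam, mem_union, mem_sdiff, mem_image, eq_comm (a := F)]

theorem sdiff_insert_insert_inj {g Q Q' : Finset ℕ} {b₁ b₂ : ℕ} (hQ : Q ⊆ g) (hQ' : Q' ⊆ g)
    (h1 : b₁ ∉ Q) (h2 : b₂ ∉ Q) (h1' : b₁ ∉ Q') (h2' : b₂ ∉ Q')
    (e : g \ insert b₁ (insert b₂ Q) = g \ insert b₁ (insert b₂ Q')) : Q = Q' := by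
  ext x
  have hx := congrArg (fun S => x ∈ S) e
  simp only [mem_sdiff, mem_insert, eq_iff_iff] at hx
  have u1 := @hQ x
  have u2 := @hQ' x
  by_cases e1 : x = b₁
  · subst e1; tauto
  by_cases e2 : x = b₂
  · subst e2; tauto
  tauto

/-- A set of at most two elements outside the triple. -/
structure SmallOff (g : Finset ℕ) (b₁ b₂ b₃ : ℕ) (Q : Finset ℕ) : Prop where
  sub : Q ⊆ g
  not₁ : b₁ ∉ Q
  not₂ : b₂ ∉ Q
  not₃ : b₃ ∉ Q
  card_le : Q.card ≤ 2

theorem SmallOff.card_ge {g Q : Finset ℕ} {b₁ b₂ b₃ : ℕ} (h : SmallOff g b₁ b₂ b₃ Q) :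
    g.card ≤ (g \ insert b₁ (insert b₂ Q)).card + 4 := by
  have h1 := le_card_sdiff (insert b₁ (insert b₂ Q)) g
  have h2 := card_insert_le b₁ (insert b₂ Q)
  have h3 := card_insert_le b₂ Q
  have := h.card_le
  omega

theorem Config.tame_tradeFam {g K N M : Finset ℕ} {b₁ b₂ b₃ : ℕ}
    (h : Config g b₁ b₂ b₃ K N M) {𝓓 𝓤 : Finset (Finset ℕ)}
    (h𝓤 : ∀ Q ∈ 𝓤, SmallOff g b₁ b₂ b₃ Q) (h𝓓 : ∀ D ∈ 𝓓, D.card ≤ 3)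
    (hN : ∀ q ∈ N, {b₁, b₂, q} ∈ 𝓓) :
    Tame g b₁ b₂ K N (tradeFam g b₁ b₂ (baseFam g b₁ b₂ K) 𝓓 𝓤) := by
  have hg := h.card_ge
  have key : ∀ F ∈ tradeFam g b₁ b₂ (baseFam g b₁ b₂ K) 𝓓 𝓤, F.card ≤ 4 →
      F ∈ baseFam g b₁ b₂ K ∧ F ∉ 𝓓 := by
    intro F hF hc
    rcases mem_tradeFam.1 hF with h1 | ⟨Q, hQ, rfl⟩
    · exact h1
    · have := (h𝓤 Q hQ).card_ge
      omega
  refine ⟨?_, ?_, ?_, ?_, ?_⟩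
  · intro F hF
    rcases mem_tradeFam.1 hF with h1 | ⟨Q, hQ, rfl⟩
    · exact (mem_baseFam.1 h1.1).1
    · exact sdiff_subset
  · exact fun F hF hc => (mem_baseFam.1 (key F hF hc).1).2.1
  · exact fun F hF hc => (mem_baseFam.1 (key F hF hc).1).2.2
  · rintro F hF q hq rfl
    exact (key _ hF (card_le_three.trans (by omega))).2 (hN q hq)
  · intro F hF hc hb
    refine mem_tradeFam.2 (Or.inl ⟨mem_baseFam.2 ⟨hF, hb, Or.inl (by omega)⟩, fun hD => ?_⟩)
    have := h𝓓 F hD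
    omega

/-- The triples `{b₁, b₂, b₃}` and `{b₁, b₂, q}` for `q ∈ N`. -/
def firstTriples (b₁ b₂ b₃ : ℕ) (N : Finset ℕ) : Finset (Finset ℕ) :=
  insert {b₁, b₂, b₃} (N.image fun q => {b₁, b₂, q})

/-- The empty set and the singletons of `N`. -/
def firstAdded (N : Finset ℕ) : Finset (Finset ℕ) := insert ∅ (N.image fun q => {q})

theorem card_firstAdded_le (N : Finset ℕ) : (firstAdded N).card ≤ N.card + 1 :=
  (card_insert_le _ _).trans (Nat.succ_le_succ card_image_le)

theorem Config.smallOff_firstAdded {g K N M : Finset ℕ} {b₁ b₂ b₃ : ℕ}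
    (h : Config g b₁ b₂ b₃ K N M) {Q : Finset ℕ} (hQ : Q ∈ firstAdded N) :
    SmallOff g b₁ b₂ b₃ Q := by
  rcases mem_insert.1 hQ with rfl | hQ
  · exact ⟨empty_subset _, by simp, by simp, by simp, by simp⟩
  · obtain ⟨q, hq, rfl⟩ := mem_image.1 hQ
    obtain ⟨h1, h2, h3⟩ := h.notN q hq
    exact ⟨singleton_subset_iff.2 (h.subN hq), by simpa using h1.symm, by simpa using h2.symm,
      by simpa using h3.symm, by simp⟩

theorem Config.smallOff_of_mem_gadgetPool {g K N M : Finset ℕ} {b₁ b₂ b₃ w : ℕ}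
    (h : Config g b₁ b₂ b₃ K N M) (hw : w ∈ M) {Q : Finset ℕ} (hQ : Q ∈ gadgetPool K N w) :
    SmallOff g b₁ b₂ b₃ Q := by
  obtain ⟨a1, a2, a3, a4, -, a5⟩ := h.disjoint_of_mem_gadgetPool hw hQ
  exact ⟨a1, a2, a3, a4, a5⟩

theorem Config.card_le_three_of_mem_firstTriples {b₁ b₂ b₃ : ℕ} {N D : Finset ℕ}
    (hD : D ∈ firstTriples b₁ b₂ b₃ N) : D.card ≤ 3 := by
  rcases mem_insert.1 hD with rfl | hD
  · exact card_le_three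
  · obtain ⟨q, -, rfl⟩ := mem_image.1 hD
    exact card_le_three

theorem Config.firstTriples_spec {g K N M : Finset ℕ} {b₁ b₂ b₃ : ℕ}
    (h : Config g b₁ b₂ b₃ K N M) {D : Finset ℕ} (hD : D ∈ firstTriples b₁ b₂ b₃ N) :
    D \ {b₁, b₂, b₃} ∈ firstAdded N ∧
      (D = {b₁, b₂, b₃} ∧ D \ {b₁, b₂, b₃} = ∅ ∨
        ∃ q ∈ N, D = {b₁, b₂, q} ∧ D \ {b₁, b₂, b₃} = {q}) := by
  rcases mem_insert.1 hD with rfl | hD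
  · simp [firstAdded]
  · obtain ⟨q, hq, rfl⟩ := mem_image.1 hD
    obtain ⟨h1, h2, h3⟩ := h.notN q hq
    have e : ({b₁, b₂, q} : Finset ℕ) \ {b₁, b₂, b₃} = {q} := by
      ext x
      simp only [mem_sdiff, mem_insert, mem_singleton]
      constructor
      · tauto
      · rintro rfl
        tauto
    rw [e]
    exact ⟨mem_insert_of_mem (mem_image_of_mem _ hq), Or.inr ⟨q, hq, rfl, rfl⟩⟩

/-- The first trade: triples containing `{b₁, b₂}` against complements. -/
theorem Config.card_interFams_le_first {g K N M : Finset ℕ} {b₁ b₂ b₃ : ℕ} (t : ℕ)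
    (h : Config g b₁ b₂ b₃ K N M) :
    (interFams t (baseFam g b₁ b₂ K)).card ≤
      (interFams t (tradeFam g b₁ b₂ (baseFam g b₁ b₂ K) (firstTriples b₁ b₂ b₃ N)
        (firstAdded N))).card := by
  have hmeet : ∀ F ∈ baseFam g b₁ b₂ K, F ∉ firstTriples b₁ b₂ b₃ N →
      ∀ D ∈ firstTriples b₁ b₂ b₃ N,
        (F ∩ (g \ insert b₁ (insert b₂ (D \ {b₁, b₂, b₃})))).Nonempty := by
    intro F hF hFD D hD
    obtain ⟨hFg, -, hF2⟩ := mem_baseFam.1 hF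
    refine inter_sdiff_nonempty_of_not_subset hFg fun hs => ?_
    rcases (h.firstTriples_spec hD).2 with ⟨-, e⟩ | ⟨q, hq, -, e⟩
    · rw [e] at hs
      rcases hF2 with h3 | ⟨κ, hκ, hFκ⟩
      · have := (card_le_card hs).trans card_le_two
        omega
      · have hb := h.notK κ hκ
        have hκF : κ ∈ F := by rcases hFκ with rfl | rfl <;> simp
        have := hs hκF
        simp [hb.1, hb.2.1] at this
    · rw [e] at hs
      rcases hF2 with h3 | ⟨κ, hκ, hFκ⟩
      · have : F = {b₁, b₂, q} := eq_of_subset_of_card_le hs (card_le_three.trans h3)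
        exact hFD (this ▸ mem_insert_of_mem (mem_image_of_mem _ hq))
      · have hb := h.notK κ hκ
        have hκF : κ ∈ F := by rcases hFκ with rfl | rfl <;> simp
        have := hs hκF
        have hκq : κ ≠ q := fun e => disjoint_left.1 h.disj hκ (e ▸ hq)
        simp [hb.1, hb.2.1, hκq] at this
  refine card_interFams_le_of_injOn (fun F => if F ∈ firstTriples b₁ b₂ b₃ N then
    g \ insert b₁ (insert b₂ (F \ {b₁, b₂, b₃})) else F) ?_ ?_ ?_
  · intro F hF
    split_ifs with hFD
    · exact mem_tradeFam.2 (Or.inr ⟨_, (h.firstTriples_spec hFD).1, rfl⟩)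
    · exact mem_tradeFam.2 (Or.inl ⟨hF, hFD⟩)
  · intro F hF F' hF' e
    have hb : ∀ G ∈ baseFam g b₁ b₂ K, ∀ Q, G ≠ g \ insert b₁ (insert b₂ Q) := by
      rintro G hG Q rfl
      simpa using (mem_baseFam.1 hG).2.1
    simp only at e
    split_ifs at e with h1 h2 h2
    · have s1 := h.smallOff_firstAdded (h.firstTriples_spec h1).1
      have s2 := h.smallOff_firstAdded (h.firstTriples_spec h2).1
      have e' := sdiff_insert_insert_inj s1.sub s2.sub s1.not₁ s1.not₂ s2.not₁ s2.not₂ e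
      rcases (h.firstTriples_spec h1).2 with ⟨a, e1⟩ | ⟨q, -, a, e1⟩ <;>
      rcases (h.firstTriples_spec h2).2 with ⟨a', e2⟩ | ⟨q', -, a', e2⟩
      · rw [a, a']
      · rw [e1, e2] at e'
        exact absurd e'.symm (singleton_ne_empty _)
      · rw [e1, e2] at e'
        exact absurd e' (singleton_ne_empty _)
      · rw [e1, e2] at e'
        rw [a, a', singleton_injective e']
    · exact absurd e.symm (hb _ hF' _)
    · exact absurd e (hb _ hF _)
    · exact e
  · intro F hF F' hF' hFF'
    split_ifs with h1 h2 h2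
    · have s1 := h.smallOff_firstAdded (h.firstTriples_spec h1).1
      have s2 := h.smallOff_firstAdded (h.firstTriples_spec h2).1
      have h3 : ∀ Q, b₃ ∉ Q → b₃ ∈ g \ insert b₁ (insert b₂ Q) := fun Q hQ => by
        simp [h.mem₃, h.ne₁₃.symm, h.ne₂₃.symm, hQ]
      exact ⟨b₃, mem_inter.2 ⟨h3 _ s1.not₃, h3 _ s2.not₃⟩⟩
    · rw [inter_comm]
      exact hmeet F' hF' h2 F h1
    · exact hmeet F hF h1 F' h2
    · exact hFF'

/-- All trades of the triples `{c, b₃, w}` with `c ∈ {b₁, b₂}` and `w ∈ M`. -/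
theorem Config.exists_trade {g K N M : Finset ℕ} {b₁ b₂ b₃ : ℕ} (t : ℕ)
    (h : Config g b₁ b₂ b₃ K N M) (P : Finset (ℕ × ℕ)) (hP : P ⊆ {b₁, b₂} ×ˢ M) :
    ∃ 𝓥 : Finset (Finset ℕ), 𝓥.card ≤ 2 * P.card ∧ (∀ Q ∈ 𝓥, SmallOff g b₁ b₂ b₃ Q) ∧
      (interFams t (baseFam g b₁ b₂ K)).card ≤
        (interFams t (tradeFam g b₁ b₂ (baseFam g b₁ b₂ K)
          (firstTriples b₁ b₂ b₃ N ∪ P.image fun p => {p.1, b₃, p.2}) (firstAdded N ∪ 𝓥))).card := by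
  induction P using Finset.induction_on with
  | empty => exact ⟨∅, by simp, by simp, by simpa using h.card_interFams_le_first t⟩
  | insert p P hp ih =>
    obtain ⟨𝓥, hc, hs, hle⟩ := ih ((subset_insert _ _).trans hP)
    obtain ⟨c, w⟩ := p
    have hcw := mem_product.1 (hP (mem_insert_self _ _))
    have hw : w ∈ M := hcw.2
    have hP2 : P.card + 1 ≤ 2 * M.card := by
      rw [← card_insert_of_notMem hp]
      refine (card_le_card hP).trans ?_
      rw [card_product, card_pair h.ne₁₂]
    have hpool := h.card_gadgetPool hw
    have h1c : 1 < (gadgetPool K N w \ 𝓥).card := by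
      have := le_card_sdiff 𝓥 (gadgetPool K N w)
      omega
    obtain ⟨Q₁, hQ₁, Q₂, hQ₂, hne⟩ := one_lt_card.1 h1c
    have h𝓤 : ∀ Q ∈ firstAdded N ∪ 𝓥, SmallOff g b₁ b₂ b₃ Q := fun Q hQ =>
      (mem_union.1 hQ).elim h.smallOff_firstAdded (hs Q)
    have hnot : ∀ Q ∈ gadgetPool K N w \ 𝓥, g \ insert b₁ (insert b₂ Q) ∉
        tradeFam g b₁ b₂ (baseFam g b₁ b₂ K)
          (firstTriples b₁ b₂ b₃ N ∪ P.image fun p => {p.1, b₃, p.2}) (firstAdded N ∪ 𝓥) := by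
      intro Q hQ hm
      obtain ⟨hQp, hQ𝓥⟩ := mem_sdiff.1 hQ
      have s1 := h.smallOff_of_mem_gadgetPool hw hQp
      rcases mem_tradeFam.1 hm with ⟨hb, -⟩ | ⟨Q', hQ', e⟩
      · simpa using (mem_baseFam.1 hb).2.1
      · have s2 := h𝓤 Q' hQ'
        have e' := sdiff_insert_insert_inj s1.sub s2.sub s1.not₁ s1.not₂ s2.not₁ s2.not₂ e
        subst e'
        rcases mem_union.1 hQ' with h1 | h1
        · rcases mem_gadgetPool.1 hQp with ⟨κ, hκ, rfl⟩ | ⟨-, -, h2⟩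
          · rcases mem_insert.1 h1 with h1 | h1
            · exact singleton_ne_empty _ h1
            · obtain ⟨q, hq, e⟩ := mem_image.1 h1
              exact disjoint_left.1 h.disj hκ (singleton_injective e ▸ hq)
          · rcases mem_insert.1 h1 with rfl | h1
            · simp at h2
            · obtain ⟨q, -, rfl⟩ := mem_image.1 h1
              simp at h2
        · exact hQ𝓥 h1
    have htame : Tame g b₁ b₂ K N (tradeFam g b₁ b₂ (baseFam g b₁ b₂ K)
        (firstTriples b₁ b₂ b₃ N ∪ P.image fun p => {p.1, b₃, p.2}) (firstAdded N ∪ 𝓥)) := by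
      refine h.tame_tradeFam h𝓤 ?_ ?_
      · intro D hD
        rcases mem_union.1 hD with hD | hD
        · exact Config.card_le_three_of_mem_firstTriples hD
        · obtain ⟨p, -, rfl⟩ := mem_image.1 hD
          exact card_le_three
      · intro q hq
        exact mem_union_left _ (mem_insert_of_mem (mem_image_of_mem _ hq))
    have hstep : (interFams t (tradeFam g b₁ b₂ (baseFam g b₁ b₂ K)
        (firstTriples b₁ b₂ b₃ N ∪ P.image fun p => {p.1, b₃, p.2}) (firstAdded N ∪ 𝓥))).card ≤
        (interFams t (insert (g \ insert b₁ (insert b₂ Q₁)) (insert (g \ insert b₁ (insert b₂ Q₂))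
          ((tradeFam g b₁ b₂ (baseFam g b₁ b₂ K)
            (firstTriples b₁ b₂ b₃ N ∪ P.image fun p => {p.1, b₃, p.2})
            (firstAdded N ∪ 𝓥)).erase {c, b₃, w})))).card := by
      have hcb := hcw.1
      simp only [mem_insert, mem_singleton] at hcb
      rcases hcb with rfl | rfl
      · exact h.card_interFams_le_step t htame hw (mem_sdiff.1 hQ₁).1 (mem_sdiff.1 hQ₂).1 hne
          (hnot _ hQ₁) (hnot _ hQ₂)
      · have := h.swap.card_interFams_le_step t htame.swap hw (mem_sdiff.1 hQ₁).1
          (mem_sdiff.1 hQ₂).1 hne (by rw [insert_comm]; exact hnot _ hQ₁)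
          (by rw [insert_comm]; exact hnot _ hQ₂)
        rwa [insert_comm c b₁ Q₁, insert_comm c b₁ Q₂] at this
    refine ⟨insert Q₁ (insert Q₂ 𝓥), ?_, ?_, hle.trans (hstep.trans (card_interFams_mono ?_))⟩
    · rw [card_insert_of_notMem hp]
      have h1 := card_insert_le Q₁ (insert Q₂ 𝓥)
      have h2 := card_insert_le Q₂ 𝓥
      omega
    · intro Q hQ
      simp only [mem_insert] at hQ
      rcases hQ with rfl | rfl | hQ
      · exact h.smallOff_of_mem_gadgetPool hw (mem_sdiff.1 hQ₁).1
      · exact h.smallOff_of_mem_gadgetPool hw (mem_sdiff.1 hQ₂).1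
      · exact hs Q hQ
    · intro F hF
      simp only [mem_insert, mem_erase] at hF
      rcases hF with rfl | rfl | ⟨hne', hF⟩
      · exact mem_tradeFam.2 (Or.inr ⟨Q₁, by simp, rfl⟩)
      · exact mem_tradeFam.2 (Or.inr ⟨Q₂, by simp, rfl⟩)
      · rcases mem_tradeFam.1 hF with ⟨h1, h2⟩ | ⟨Q, hQ, rfl⟩
        · refine mem_tradeFam.2 (Or.inl ⟨h1, fun h3 => h2 ?_⟩)
          rw [image_insert, mem_union, mem_insert] at h3
          rcases h3 with h3 | h3 | h3
          · exact mem_union_left _ h3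
          · exact absurd h3 hne'
          · exact mem_union_right _ h3
        · refine mem_tradeFam.2 (Or.inr ⟨Q, ?_, rfl⟩)
          rcases mem_union.1 hQ with hQ | hQ
          · exact mem_union_left _ hQ
          · exact mem_union_right _ (mem_insert_of_mem (mem_insert_of_mem hQ))

/-- A triple inside `M ∪ B` having two points in `B = {b₁, b₂, b₃}` is among the traded ones. -/
theorem Config.mem_of_trace {g K N M F : Finset ℕ} {b₁ b₂ b₃ : ℕ}
    (h : Config g b₁ b₂ b₃ K N M) (hb : b₁ ∈ F ∨ b₂ ∈ F) (hFc : F.card = 3)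
    (h2 : 2 ≤ (F ∩ {b₁, b₂, b₃}).card) (hFs : F ⊆ M ∪ {b₁, b₂, b₃}) :
    F ∈ firstTriples b₁ b₂ b₃ N ∪
      ({b₁, b₂} ×ˢ M).image fun p => ({p.1, b₃, p.2} : Finset ℕ) := by
  have htri : ∀ x y z : ℕ, x ∈ F → y ∈ F → z ∈ F → x ≠ y → x ≠ z → y ≠ z →
      F = {x, y, z} := by
    intro x y z hx hy hz hxy hxz hyz
    refine (eq_of_subset_of_card_le ?_ ?_).symm
    · intro u hu
      simp only [mem_insert, mem_singleton] at hu
      rcases hu with rfl | rfl | rfl <;> assumption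
    · rw [hFc, card_eq_three.2 ⟨x, y, z, hxy, hxz, hyz, rfl⟩]
  by_cases h12 : b₁ ∈ F ∧ b₂ ∈ F
  · obtain ⟨z, hzF, hz1, hz2⟩ : ∃ z ∈ F, z ≠ b₁ ∧ z ≠ b₂ := by
      by_contra! hno
      have : F ⊆ {b₁, b₂} := fun x hx => by
        have := hno x hx
        simp only [mem_insert, mem_singleton]
        tauto
      have := (card_le_card this).trans card_le_two
      omega
    have e := htri b₁ b₂ z h12.1 h12.2 hzF h.ne₁₂ hz1.symm hz2.symm
    refine mem_union_left _ ?_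
    have := hFs hzF
    simp only [mem_union, mem_insert, mem_singleton, hz1, hz2, false_or] at this
    rcases this with hz | rfl
    · rw [e]
      exact mem_insert_of_mem (mem_image_of_mem _ (h.subM hz))
    · rw [e]
      exact mem_insert_self _ _
  · have hcase : ∃ c, (c = b₁ ∨ c = b₂) ∧ c ∈ F ∧ b₃ ∈ F ∧
        (F ∩ {b₁, b₂, b₃}) ⊆ {c, b₃} := by
      have aux : ∀ c, (∀ x ∈ F, x = b₁ ∨ x = b₂ ∨ x = b₃ → x = c ∨ x = b₃) →
          b₃ ∈ F := by
        intro c hh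
        by_contra h3'
        have : F ∩ {b₁, b₂, b₃} ⊆ {c} := by
          intro x hx
          simp only [mem_inter, mem_insert, mem_singleton] at hx ⊢
          rcases hh x hx.1 hx.2 with e | rfl
          · exact e
          · exact absurd hx.1 h3'
        have := card_le_card this
        simp only [card_singleton] at this
        omega
      rcases hb with hb | hb
      · have hb2 : b₂ ∉ F := fun e => h12 ⟨hb, e⟩
        have hh : ∀ x ∈ F, x = b₁ ∨ x = b₂ ∨ x = b₃ → x = b₁ ∨ x = b₃ := by
          rintro x hx (rfl | rfl | rfl)
          · tauto
          · exact absurd hx hb2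
          · tauto
        refine ⟨b₁, Or.inl rfl, hb, aux b₁ hh, fun x hx => ?_⟩
        simp only [mem_inter, mem_insert, mem_singleton] at hx ⊢
        exact hh x hx.1 hx.2
      · have hb1 : b₁ ∉ F := fun e => h12 ⟨e, hb⟩
        have hh : ∀ x ∈ F, x = b₁ ∨ x = b₂ ∨ x = b₃ → x = b₂ ∨ x = b₃ := by
          rintro x hx (rfl | rfl | rfl)
          · exact absurd hx hb1
          · tauto
          · tauto
        refine ⟨b₂, Or.inr rfl, hb, aux b₂ hh, fun x hx => ?_⟩
        simp only [mem_inter, mem_insert, mem_singleton] at hx ⊢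
        exact hh x hx.1 hx.2
    obtain ⟨c, hcb, hcF, h3F, hsub⟩ := hcase
    have hc3 : c ≠ b₃ := by
      rcases hcb with rfl | rfl
      exacts [h.ne₁₃, h.ne₂₃]
    obtain ⟨z, hzF, hz1, hz2⟩ : ∃ z ∈ F, z ≠ c ∧ z ≠ b₃ := by
      by_contra! hno
      have : F ⊆ {c, b₃} := fun x hx => by
        have := hno x hx
        simp only [mem_insert, mem_singleton]
        tauto
      have := (card_le_card this).trans card_le_two
      omega
    have e := htri c b₃ z hcF h3F hzF hc3 hz1.symm hz2.symm
    refine mem_union_right _ (mem_image.2 ⟨(c, z), mem_product.2 ⟨?_, ?_⟩, e.symm⟩)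
    · simpa using hcb
    · rcases mem_union.1 (hFs hzF) with hz | hz
      · exact hz
      · have := hsub (mem_inter.2 ⟨hzF, hz⟩)
        simp [hz1, hz2] at this

theorem card_pair_inter_le {B : Finset ℕ} {κ : ℕ} (c : ℕ) (hκ : κ ∉ B) :
    (({c, κ} : Finset ℕ) ∩ B).card ≤ 1 := by
  rw [← card_singleton c]
  refine card_le_card fun x hx => ?_
  obtain ⟨hx1, hx2⟩ := mem_inter.1 hx
  rcases mem_insert.1 hx1 with rfl | hx1
  · exact mem_singleton_self _
  · exact absurd (mem_singleton.1 hx1 ▸ hx2) hκ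

/-- After all trades, the small members meet the triple in one point or leave `M ∪ B`. -/
theorem Config.exists_dominating {g K N M : Finset ℕ} {b₁ b₂ b₃ : ℕ} (t : ℕ)
    (h : Config g b₁ b₂ b₃ K N M) :
    ∃ 𝓗 : Finset (Finset ℕ), (interFams t (baseFam g b₁ b₂ K)).card ≤ (interFams t 𝓗).card ∧
      𝓗.card + 2 ^ (g.card - 2) ≤ 2 ^ g.card + 5 * g.card ∧
      (∀ F ∈ 𝓗, F ⊆ g ∧ (F ∩ {b₁, b₂, b₃}).Nonempty) ∧
      (∀ F ∈ 𝓗, 2 ≤ (F ∩ {b₁, b₂, b₃}).card →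
        4 ≤ F.card ∨ (F.card = 3 ∧ ¬ F ⊆ M ∪ {b₁, b₂, b₃})) ∧
      (∀ F ⊆ g, 2 ≤ (F ∩ {b₁, b₂, b₃}).card → 4 ≤ F.card → F ∈ 𝓗) := by
  obtain ⟨𝓥, hc, hs, hle⟩ := h.exists_trade t ({b₁, b₂} ×ˢ M) Subset.rfl
  have hg := h.card_ge
  have h𝓤 : ∀ Q ∈ firstAdded N ∪ 𝓥, SmallOff g b₁ b₂ b₃ Q := fun Q hQ =>
    (mem_union.1 hQ).elim h.smallOff_firstAdded (hs Q)
  have hD3 : ∀ D ∈ firstTriples b₁ b₂ b₃ N ∪ ({b₁, b₂} ×ˢ M).image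
      fun p => ({p.1, b₃, p.2} : Finset ℕ), D.card ≤ 3 := by
    intro D hD
    rcases mem_union.1 hD with hD | hD
    · exact Config.card_le_three_of_mem_firstTriples hD
    · obtain ⟨p, -, rfl⟩ := mem_image.1 hD
      exact card_le_three
  refine ⟨_, hle, ?_, ?_, ?_, ?_⟩
  · have h1 := h.card_baseFam
    have h2 : (tradeFam g b₁ b₂ (baseFam g b₁ b₂ K)
        (firstTriples b₁ b₂ b₃ N ∪ ({b₁, b₂} ×ˢ M).image fun p => {p.1, b₃, p.2})
        (firstAdded N ∪ 𝓥)).card ≤ (baseFam g b₁ b₂ K).card + ((N.card + 1) + 2 * (2 * M.card)) := by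
      refine (card_union_le _ _).trans (add_le_add (card_le_card sdiff_subset) ?_)
      refine card_image_le.trans ((card_union_le _ _).trans
        (add_le_add (card_firstAdded_le N) ?_))
      rwa [card_product, card_pair h.ne₁₂] at hc
    have h3 := h.card_eq
    have h4 := h.cardN
    omega
  · intro F hF
    rcases mem_tradeFam.1 hF with ⟨h1, -⟩ | ⟨Q, hQ, rfl⟩
    · obtain ⟨h2, h3 | h3, -⟩ := mem_baseFam.1 h1
      · exact ⟨h2, b₁, by simp [h3]⟩
      · exact ⟨h2, b₂, by simp [h3]⟩
    · refine ⟨sdiff_subset, b₃, ?_⟩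
      simp [h.mem₃, h.ne₁₃.symm, h.ne₂₃.symm, (h𝓤 Q hQ).not₃]
  · intro F hF h2
    by_contra! hcon
    obtain ⟨hF4, hF3⟩ := hcon
    rcases mem_tradeFam.1 hF with ⟨h1, hnD⟩ | ⟨Q, hQ, rfl⟩
    · obtain ⟨hFg, hb, h3 | ⟨κ, hκ, hFκ⟩⟩ := mem_baseFam.1 h1
      · exact hnD (h.mem_of_trace hb (by omega) h2 (hF3 (by omega)))
      · have hb := h.notK κ hκ
        have hκB : κ ∉ ({b₁, b₂, b₃} : Finset ℕ) := by simp [hb.1, hb.2.1, hb.2.2]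
        rcases hFκ with rfl | rfl
        · have := card_pair_inter_le b₁ hκB
          omega
        · have := card_pair_inter_le b₂ hκB
          omega
    · have := (h𝓤 Q hQ).card_ge
      omega
  · intro F hFg h2 h4
    refine mem_tradeFam.2 (Or.inl ⟨mem_baseFam.2 ⟨hFg, ?_, Or.inl (by omega)⟩, fun hD => ?_⟩)
    · by_contra! hno
      have : F ∩ {b₁, b₂, b₃} ⊆ {b₃} := by
        intro x hx
        simp only [mem_inter, mem_insert, mem_singleton] at hx ⊢
        rcases hx with ⟨hx, rfl | rfl | rfl⟩
        · exact absurd hx hno.1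
        · exact absurd hx hno.2
        · rfl
      have := card_le_card this
      simp only [card_singleton] at this
      omega
    · have := hD3 F hD
      omega

/-- Members of `𝓗` meet `B`; those with at least two points in `B` are large or leave `L`, and all
large sets with at least two points in `B` are members. -/
structure Traced (g B L : Finset ℕ) (𝓗 : Finset (Finset ℕ)) : Prop where
  sub : ∀ F ∈ 𝓗, F ⊆ g
  meet : ∀ F ∈ 𝓗, (F ∩ B).Nonempty
  small : ∀ F ∈ 𝓗, 2 ≤ (F ∩ B).card → 4 ≤ F.card ∨ (F.card = 3 ∧ ¬ F ⊆ L)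
  large : ∀ F ⊆ g, 2 ≤ (F ∩ B).card → 4 ≤ F.card → F ∈ 𝓗

theorem Exchangeable.card_moveSet_inter {U V S B : Finset ℕ} (h : Exchangeable U V S)
    (hB : (U ∩ B).card = (V ∩ B).card) : (moveSet U V S ∩ B).card = (S ∩ B).card := by
  have h1 : Exchangeable (U ∩ B) (V ∩ B) (S ∩ B) :=
    ⟨inter_subset_inter_right h.1, h.2.mono inter_subset_left inter_subset_left⟩
  have e : moveSet U V S ∩ B = moveSet (U ∩ B) (V ∩ B) (S ∩ B) := by
    ext x
    simp only [moveSet, mem_inter, mem_union, mem_sdiff]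
    tauto
  have := h1.card_moveSet
  rw [e]
  omega

theorem moveSet_subset {U V S g : Finset ℕ} (hS : S ⊆ g) (hV : V ⊆ g) : moveSet U V S ⊆ g :=
  union_subset (sdiff_subset.trans hS) hV

theorem Traced.not_movable {g B L U V S : Finset ℕ} {𝓗 : Finset (Finset ℕ)}
    (h : Traced g B L 𝓗) (hV : V ⊆ g) (hUV : V.card = U.card + 1)
    (hB : (U ∩ B).card = (V ∩ B).card) (hS : S ∈ 𝓗) (h2 : 2 ≤ (S ∩ B).card) :
    ¬ Movable U V 𝓗 S := by
  intro hm
  refine hm.2 (h.large _ (moveSet_subset (h.sub S hS) hV) ?_ ?_)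
  · rwa [hm.1.card_moveSet_inter hB]
  · have := hm.1.card_moveSet
    have := h.small S hS h2
    omega

theorem Traced.compress {g B L U V : Finset ℕ} {𝓗 : Finset (Finset ℕ)} (h : Traced g B L 𝓗)
    (hV : V ⊆ g) (hUV : V.card = U.card + 1) (hB : (U ∩ B).card = (V ∩ B).card) :
    Traced g B L (compress U V 𝓗) where
  sub := by
    intro F hF
    rcases mem_compress.1 hF with ⟨h1, -⟩ | ⟨K, hK, hm, rfl⟩
    · exact h.sub F h1
    · exact moveSet_subset (h.sub K hK) hV
  meet := by
    intro F hF
    rcases mem_compress.1 hF with ⟨h1, -⟩ | ⟨K, hK, hm, rfl⟩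
    · exact h.meet F h1
    · rw [← card_pos, hm.1.card_moveSet_inter hB, card_pos]
      exact h.meet K hK
  small := by
    intro F hF h2
    rcases mem_compress.1 hF with ⟨h1, -⟩ | ⟨K, hK, hm, rfl⟩
    · exact h.small F h1 h2
    · rw [hm.1.card_moveSet_inter hB] at h2
      exact absurd hm (h.not_movable hV hUV hB hK h2)
  large := by
    intro F hF h2 h4
    have h1 := h.large F hF h2 h4
    exact mem_compress.2 (Or.inl ⟨h1, h.not_movable hV hUV hB h1 h2⟩)

/-- Compressing as long as possible while keeping the trace on `B`. -/
theorem Traced.exists_closed {g B L : Finset ℕ} {𝓗 : Finset (Finset ℕ)} (t : ℕ)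
    (h : Traced g B L 𝓗) :
    ∃ 𝓗', Traced g B L 𝓗' ∧ 𝓗'.card = 𝓗.card ∧ (interFams t 𝓗).card ≤ (interFams t 𝓗').card ∧
      ∀ U V : Finset ℕ, U.card ≤ 1 → V.card = U.card + 1 → V ⊆ g →
        (U ∩ B).card = (V ∩ B).card → ∀ S ∈ 𝓗', Exchangeable U V S → moveSet U V S ∈ 𝓗' := by
  classical
  let 𝓢 := g.powerset.powerset.filter fun 𝓗' => Traced g B L 𝓗' ∧ 𝓗'.card = 𝓗.card ∧
    (interFams t 𝓗).card ≤ (interFams t 𝓗').card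
  have hsub : ∀ 𝓗', Traced g B L 𝓗' → 𝓗' ∈ g.powerset.powerset := fun 𝓗' h' =>
    mem_powerset.2 fun F hF => mem_powerset.2 (h'.sub F hF)
  obtain ⟨𝓗', h', hmax⟩ := exists_max_image 𝓢 (fun 𝓗' => ∑ S ∈ 𝓗', S.card)
    ⟨𝓗, mem_filter.2 ⟨hsub 𝓗 h, h, rfl, le_rfl⟩⟩
  obtain ⟨-, h1, h2, h3⟩ := mem_filter.1 h'
  refine ⟨𝓗', h1, h2, h3, fun U V hU hUV hV hB S hS hE => ?_⟩
  by_contra hno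
  have h4 := h1.compress hV hUV hB
  have hlt := sum_card_lt_sum_card_compress (by omega) hS (⟨hE, hno⟩ : Movable U V 𝓗' S)
  have hmem : _root_.compress U V 𝓗' ∈ 𝓢 := mem_filter.2 ⟨hsub _ h4, h4, by rw [card_compress, h2],
    h3.trans (card_interFams_le_compress t hU (card_pos.1 (by omega)))⟩
  exact absurd (hmax _ hmem) (not_le.2 hlt)

theorem mem_of_small_trace {g B : Finset ℕ} {𝓗 : Finset (Finset ℕ)}
    (hcl : ∀ U V : Finset ℕ, U.card ≤ 1 → V.card = U.card + 1 → V ⊆ g →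
      (U ∩ B).card = (V ∩ B).card → ∀ S ∈ 𝓗, Exchangeable U V S → moveSet U V S ∈ 𝓗)
    {F T : Finset ℕ} (hF : F ∈ 𝓗) (hFg : F ⊆ g) (hT : T ⊆ g) (hFB : (F ∩ B).card = 1)
    (hTB : (T ∩ B).card = 1) (hF3 : F.card ≤ 3) (hT6 : 6 ≤ T.card) : T ∈ 𝓗 := by
  have hex : ExchangeClosed (g \ B) 𝓗 := by
    intro U V hU hUV hUR hVR _ S hS hE
    have e : ∀ W ⊆ g \ B, W ∩ B = ∅ := fun W hW =>
      disjoint_iff_inter_eq_empty.1 (disjoint_sdiff_self_left.mono_left hW)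
    exact hcl U V hU hUV (hVR.trans sdiff_subset) (by rw [e U hUR, e V hVR]) S hS hE
  have key : ∀ G ∈ 𝓗, G ⊆ g → G ∩ B = T ∩ B → G.card + 2 ≤ (G ∩ T).card + 4 →
      2 * G.card ≤ (G ∩ T).card + T.card → T ∈ 𝓗 := by
    intro G hG hGg e h1 h2
    have hb : ∀ x, (x ∈ G ∧ x ∈ B) ↔ (x ∈ T ∧ x ∈ B) := fun x => by
      rw [← mem_inter, ← mem_inter, e]
    refine hex.mem_of_two_mul_le hG ?_ ?_ ?_
    · intro x hx
      have := hb x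
      have := @hGg x
      rw [mem_sdiff] at hx ⊢
      tauto
    · intro x hx
      have := hb x
      have := @hT x
      rw [mem_sdiff] at hx ⊢
      tauto
    · have := card_sdiff_add_card_inter G T
      have := card_sdiff_add_card_inter T G
      rw [inter_comm T G] at this
      omega
  obtain ⟨b, hb⟩ := card_eq_one.1 hFB
  obtain ⟨b', hb'⟩ := card_eq_one.1 hTB
  have hbF := mem_inter.1 (hb ▸ mem_singleton_self b)
  have hbT := mem_inter.1 (hb' ▸ mem_singleton_self b')
  by_cases hbb : b = b'
  · subst hbb
    have : 0 < (F ∩ T).card := card_pos.2 ⟨b, mem_inter.2 ⟨hbF.1, hbT.1⟩⟩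
    exact key F hF hFg (hb.trans hb'.symm) (by omega) (by omega)
  · have hr : ((T \ B) \ F).Nonempty := by
      rw [← card_pos]
      have h1 := card_sdiff_add_card_inter T B
      have h2 := card_sdiff_add_card_inter F B
      have h3 := le_card_sdiff F (T \ B)
      omega
    obtain ⟨r, hr⟩ := hr
    obtain ⟨hrTB, hrF⟩ := mem_sdiff.1 hr
    obtain ⟨hrT, hrB⟩ := mem_sdiff.1 hrTB
    have hb'r : b' ≠ r := fun e => hrB (e ▸ hbT.2)
    have hb'F : b' ∉ F := fun hm => hbb
      (mem_singleton.1 (hb ▸ mem_inter.2 ⟨hm, hbT.2⟩ : b' ∈ ({b} : Finset ℕ))).symm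
    have hV : ({b', r} : Finset ℕ) ⊆ g := by
      intro x hx
      rcases mem_insert.1 hx with rfl | hx
      · exact hT hbT.1
      · exact mem_singleton.1 hx ▸ hT hrT
    have hE : Exchangeable {b} {b', r} F := by
      refine ⟨by simpa using hbF.1, disjoint_left.2 fun x hx => ?_⟩
      rcases mem_insert.1 hx with rfl | hx
      · exact hb'F
      · exact mem_singleton.1 hx ▸ hrF
    have e1 : ({b} : Finset ℕ) ∩ B = {b} := by simpa using hbF.2
    have e2 : ({b', r} : Finset ℕ) ∩ B = {b'} := by
      ext x
      simp only [mem_inter, mem_insert, mem_singleton]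
      constructor
      · rintro ⟨rfl | rfl, hx⟩
        · rfl
        · exact absurd hx hrB
      · rintro rfl
        exact ⟨Or.inl rfl, hbT.2⟩
    have hm := hcl {b} {b', r} (by simp) (by simp [card_pair hb'r]) hV (by simp [e1, e2]) F hF hE
    have e3 : moveSet {b} {b', r} F ∩ B = T ∩ B := by
      rw [hb']
      refine (eq_of_subset_of_card_le ?_ ?_).symm
      · exact singleton_subset_iff.2 (mem_inter.2 ⟨subset_moveSet F (by simp), hbT.2⟩)
      · rw [hE.card_moveSet_inter (by simp [e1, e2]), hFB, card_singleton]
    have hc := hE.card_moveSet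
    rw [card_singleton, card_pair hb'r] at hc
    have hi : 2 ≤ (moveSet {b} {b', r} F ∩ T).card := by
      rw [← card_pair hb'r]
      refine card_le_card (subset_inter (subset_moveSet F) ?_)
      intro x hx
      rcases mem_insert.1 hx with rfl | hx
      · exact hbT.1
      · exact mem_singleton.1 hx ▸ hrT
    exact key _ hm (moveSet_subset hFg hV) e3 (by omega) (by omega)

theorem sum_choose_lt_two_pow {n : ℕ} (hn : 21 ≤ n) :
    5 * n + ∑ i ∈ range 6, n.choose i < 2 ^ (n - 3) := by
  induction n, hn using Nat.le_induction with
  | base => decide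
  | succ n hn ih =>
    have e : n + 1 - 3 = (n - 3) + 1 := by omega
    rw [e, pow_succ]
    have c2 : (n + 1).choose 2 = n.choose 1 + n.choose 2 := Nat.choose_succ_succ n 1
    have c3 : (n + 1).choose 3 = n.choose 2 + n.choose 3 := Nat.choose_succ_succ n 2
    have c4 : (n + 1).choose 4 = n.choose 3 + n.choose 4 := Nat.choose_succ_succ n 3
    have c5 : (n + 1).choose 5 = n.choose 4 + n.choose 5 := Nat.choose_succ_succ n 4
    simp only [sum_range_succ, range_zero, sum_empty, Nat.choose_zero_right, zero_add,
      Nat.choose_one_right, c2, c3, c4, c5] at ih ⊢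
    omega

theorem card_filter_card_lt_six (g : Finset ℕ) :
    (g.powerset.filter fun Q => Q.card < 6).card = ∑ i ∈ range 6, g.card.choose i := by
  rw [card_eq_sum_card_fiberwise (f := card) (t := range 6)
    (fun Q hQ => by simpa using (mem_filter.1 hQ).2)]
  refine sum_congr rfl fun i hi => ?_
  rw [← card_powersetCard]
  congr 1
  ext Q
  have := mem_range.1 hi
  simp only [mem_filter, mem_powerset, mem_powersetCard]
  constructor
  · tauto
  · rintro ⟨h1, h2⟩
    exact ⟨⟨h1, by omega⟩, h2⟩

theorem exists_notMem_of_card_le {g B : Finset ℕ} {𝓗 : Finset (Finset ℕ)} (hg : 21 ≤ g.card)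
    (hB : B ⊆ g) (hB3 : B.card = 3)
    (hc : 𝓗.card + 2 ^ (g.card - 2) ≤ 2 ^ g.card + 5 * g.card) :
    ∃ Q ⊆ g, (Q ∩ B).Nonempty ∧ 6 ≤ Q.card ∧ Q ∉ 𝓗 := by
  by_contra! hno
  have hsub : g.powerset ⊆ 𝓗 ∪ ((g \ B).powerset ∪ g.powerset.filter fun Q => Q.card < 6) := by
    intro Q hQ
    have hQg := mem_powerset.1 hQ
    by_cases h6 : 6 ≤ Q.card
    · by_cases hQB : (Q ∩ B).Nonempty
      · exact mem_union_left _ (hno Q hQg hQB h6)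
      · refine mem_union_right _ (mem_union_left _ (mem_powerset.2 fun x hx => ?_))
        exact mem_sdiff.2 ⟨hQg hx, fun hxB => hQB ⟨x, mem_inter.2 ⟨hx, hxB⟩⟩⟩
    · exact mem_union_right _ (mem_union_right _ (mem_filter.2 ⟨hQ, by omega⟩))
  have h1 := (card_le_card hsub).trans ((card_union_le _ _).trans
    (Nat.add_le_add_left (card_union_le _ _) _))
  rw [card_powerset, card_powerset, card_filter_card_lt_six, card_sdiff_of_subset hB, hB3] at h1
  have h2 := sum_choose_lt_two_pow hg
  have e : g.card - 2 = (g.card - 3) + 1 := by omega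
  rw [e, pow_succ] at hc
  omega

/-- A family that dominates, has only large members or triples leaving `L`, and misses some large
set meeting `B`. -/
theorem Traced.exists_deficient {g B L : Finset ℕ} {𝓗 : Finset (Finset ℕ)} (t : ℕ)
    (h : Traced g B L 𝓗) (hg : 21 ≤ g.card) (hB : B ⊆ g) (hB3 : B.card = 3)
    (hc : 𝓗.card + 2 ^ (g.card - 2) ≤ 2 ^ g.card + 5 * g.card) :
    ∃ 𝓗', (interFams t 𝓗).card ≤ (interFams t 𝓗').card ∧
      (∀ F ∈ 𝓗', F ⊆ g ∧ (F ∩ B).Nonempty ∧ (4 ≤ F.card ∨ (F.card = 3 ∧ ¬ F ⊆ L))) ∧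
      ∃ Q ⊆ g, (Q ∩ B).Nonempty ∧ 6 ≤ Q.card ∧ Q ∉ 𝓗' := by
  obtain ⟨𝓗', h', hc', hle, hcl⟩ := h.exists_closed t
  obtain ⟨Q, hQ, hQB, hQ6, hQ𝓗⟩ := exists_notMem_of_card_le (𝓗 := 𝓗') hg hB hB3 (by rwa [hc'])
  refine ⟨𝓗', hle, fun F hF => ⟨h'.sub F hF, h'.meet F hF, ?_⟩, Q, hQ, hQB, hQ6, hQ𝓗⟩
  by_cases h2 : 2 ≤ (F ∩ B).card
  · exact h'.small F hF h2
  · left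
    by_contra! h3
    have hFB := card_pos.2 (h'.meet F hF)
    have hQB' := card_pos.2 hQB
    have hQ1 : ¬ 2 ≤ (Q ∩ B).card := fun h2 => hQ𝓗 (h'.large Q hQ h2 (by omega))
    exact hQ𝓗 (mem_of_small_trace hcl hF (h'.sub F hF) hQ (by omega) (by omega) (by omega) hQ6)

/-- The two halves combined. -/
theorem Config.exists_deficient {g K N M : Finset ℕ} {b₁ b₂ b₃ : ℕ} (t : ℕ)
    (h : Config g b₁ b₂ b₃ K N M) :
    ∃ 𝓗, (interFams t (baseFam g b₁ b₂ K)).card ≤ (interFams t 𝓗).card ∧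
      (∀ F ∈ 𝓗, F ⊆ g ∧ (F ∩ {b₁, b₂, b₃}).Nonempty ∧
        (4 ≤ F.card ∨ (F.card = 3 ∧ ¬ F ⊆ M ∪ {b₁, b₂, b₃}))) ∧
      ∃ Q ⊆ g, (Q ∩ {b₁, b₂, b₃}).Nonempty ∧ 6 ≤ Q.card ∧ Q ∉ 𝓗 := by
  obtain ⟨𝓗, hle, hc, h1, h2, h3⟩ := h.exists_dominating t
  have htr : Traced g {b₁, b₂, b₃} (M ∪ {b₁, b₂, b₃}) 𝓗 :=
    ⟨fun F hF => (h1 F hF).1, fun F hF => (h1 F hF).2, h2, h3⟩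
  have hBg : ({b₁, b₂, b₃} : Finset ℕ) ⊆ g :=
    insert_subset h.mem₁ (insert_subset h.mem₂ (singleton_subset_iff.2 h.mem₃))
  obtain ⟨𝓗', hle', h4, h5⟩ := htr.exists_deficient t h.card_ge hBg
    (card_eq_three.2 ⟨b₁, b₂, b₃, h.ne₁₂, h.ne₁₃, h.ne₂₃, rfl⟩) hc
  exact ⟨𝓗', hle.trans hle', h4, h5⟩

theorem ExchangeClosed.mem_of_card {n : ℕ} {𝓐 : Finset (Finset ℕ)}
    (h : ExchangeClosed (groundSet n) 𝓐) {S T : Finset ℕ} (hS : S ∈ 𝓐) (hSg : S ⊆ groundSet n)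
    (hT : T ⊆ groundSet n) (hc : 2 * S.card ≤ T.card + (S ∩ T).card) : T ∈ 𝓐 := by
  refine h.mem_of_two_mul_le hS (sdiff_subset.trans hSg) (sdiff_subset.trans hT) ?_
  have h1 := card_sdiff_add_card_inter S T
  have h2 := card_sdiff_add_card_inter T S
  rw [inter_comm T S] at h2
  omega

theorem image_perm_subset {σ : Equiv.Perm ℕ} {g F : Finset ℕ} (h : ∀ x ∈ g, σ x ∈ g)
    (hF : F ⊆ g) : F.image σ ⊆ g := by
  intro x hx
  obtain ⟨y, hy, rfl⟩ := mem_image.1 hx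
  exact h y (hF hy)

/-- The union of the pairs in `𝓐`. -/
def pairSupport (𝓐 : Finset (Finset ℕ)) : Finset ℕ := (𝓐.filter fun A => A.card = 2).biUnion id

theorem mem_pairSupport {𝓐 : Finset (Finset ℕ)} {x : ℕ} :
    x ∈ pairSupport 𝓐 ↔ ∃ A ∈ 𝓐, A.card = 2 ∧ x ∈ A := by
  simp [pairSupport, and_assoc]

theorem ExchangeClosed.mem_of_mem_pairSupport {n x : ℕ} {𝓐 : Finset (Finset ℕ)}
    (h : ExchangeClosed (groundSet n) 𝓐) (h𝓐 : 𝓐 ⊆ allFams n) {T : Finset ℕ}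
    (hT : T ⊆ groundSet n) (hT3 : T.card = 3) (hxT : x ∈ T) (hx : x ∈ pairSupport 𝓐) : T ∈ 𝓐 := by
  obtain ⟨A, hA, hA2, hxA⟩ := mem_pairSupport.1 hx
  have : 0 < (A ∩ T).card := card_pos.2 ⟨x, mem_inter.2 ⟨hxA, hxT⟩⟩
  exact h.mem_of_card hA (mem_powerset.1 (h𝓐 hA)) hT (by omega)

theorem image_mem_baseFam {g K A F : Finset ℕ} {b₁ b₂ : ℕ} {σ : Equiv.Perm ℕ}
    (hσg : ∀ x ∈ g, σ x ∈ g) (hσA : A.image σ = {b₁, b₂}) (hF : F ⊆ g) (hFA : (F ∩ A).Nonempty)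
    (hF2 : 3 ≤ F.card ∨ ∃ a ∈ A, ∃ κ ∈ K, σ κ = κ ∧ F = {a, κ}) :
    F.image σ ∈ baseFam g b₁ b₂ K := by
  have hσ : ∀ a ∈ A, σ a = b₁ ∨ σ a = b₂ := fun a ha => by
    have := mem_image_of_mem σ ha
    rw [hσA] at this
    simpa using this
  refine mem_baseFam.2 ⟨image_perm_subset hσg hF, ?_, ?_⟩
  · obtain ⟨x, hx⟩ := hFA
    obtain ⟨hxF, hxA⟩ := mem_inter.1 hx
    have hm := mem_image_of_mem σ hxF
    rcases hσ x hxA with e | e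
    · exact Or.inl (e ▸ hm)
    · exact Or.inr (e ▸ hm)
  · rcases hF2 with h3 | ⟨a, ha, κ, hκ, hσκ, rfl⟩
    · left
      rwa [card_image_of_injective _ σ.injective]
    · right
      refine ⟨κ, hκ, ?_⟩
      rw [image_insert, image_singleton, hσκ]
      rcases hσ a ha with e | e
      · exact Or.inl (by rw [e])
      · exact Or.inr (by rw [e])

theorem config_of_disjoint {g A Ks : Finset ℕ} {b₁ b₂ b₃ : ℕ} (hg : 21 ≤ g.card)
    (hB : {b₁, b₂, b₃} ⊆ g) (h12 : b₁ ≠ b₂) (h13 : b₁ ≠ b₃) (h23 : b₂ ≠ b₃) (hK : Ks ⊆ g)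
    (hA : A ⊆ Ks) (hA2 : A.card = 2) (hd : Disjoint Ks {b₁, b₂, b₃}) :
    Config g b₁ b₂ b₃ (Ks \ A) ((g \ {b₁, b₂, b₃}) \ Ks ∪ A) ((g \ {b₁, b₂, b₃}) \ Ks) := by
  have hKB : ∀ x ∈ Ks, x ≠ b₁ ∧ x ≠ b₂ ∧ x ≠ b₃ := fun x hx => by
    simpa using disjoint_left.1 hd hx
  refine ⟨hg, hB (by simp), hB (by simp), hB (by simp), h12, h13, h23, sdiff_subset.trans hK,
    union_subset (sdiff_subset.trans sdiff_subset) (hA.trans hK), ?_,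
    fun x hx => hKB x (sdiff_subset hx), ?_, ?_, subset_union_left, ?_⟩
  · refine disjoint_left.2 fun x hx hx' => ?_
    obtain ⟨h1, h2⟩ := mem_sdiff.1 hx
    rcases mem_union.1 hx' with h3 | h3
    · exact (mem_sdiff.1 h3).2 h1
    · exact h2 h3
  · intro x hx
    rcases mem_union.1 hx with h3 | h3
    · simpa using (mem_sdiff.1 (mem_sdiff.1 h3).1).2
    · exact hKB x (hA h3)
  · intro x hx
    by_cases hxB : x ∈ ({b₁, b₂, b₃} : Finset ℕ)
    · simp only [mem_insert, mem_singleton] at hxB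
      tauto
    · by_cases hxA : x ∈ A
      · simp [hxA]
      · by_cases hxK : x ∈ Ks
        · exact Or.inr (Or.inr (Or.inr (Or.inl (mem_sdiff.2 ⟨hxK, hxA⟩))))
        · exact Or.inr (Or.inr (Or.inr (Or.inr (mem_union_left _
            (mem_sdiff.2 ⟨mem_sdiff.2 ⟨hx, hxB⟩, hxK⟩)))))
  · rw [card_union_of_disjoint (disjoint_sdiff_self_left.mono_right hA), hA2]

/-- A closed family containing a pair but missing a triple can be improved. -/
theorem exists_improvement_of_missing_triple {n s : ℕ} (hn : 21 ≤ n) (hs1 : 2 ≤ s)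
    (hs2 : s ≤ 2 ^ (n - 1)) {𝓐 : Finset (Finset ℕ)} (h𝓐 : 𝓐 ⊆ allFams n)
    (hcl : ExchangeClosed (groundSet n) 𝓐) {A B : Finset ℕ} (hA : A ∈ 𝓐) (hA2 : A.card = 2)
    (hB : B ⊆ groundSet n) (hB3 : B.card = 3) (hB𝓐 : B ∉ 𝓐) :
    ∃ 𝓐' ⊆ allFams n, 𝓐'.card = 𝓐.card ∧ (interFams s 𝓐).card < (interFams s 𝓐').card := by
  have hsub : ∀ F ∈ 𝓐, F ⊆ groundSet n := fun F hF => mem_powerset.1 (h𝓐 hF)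
  have hAg := hsub A hA
  have h4 : ∀ F ⊆ groundSet n, 4 ≤ F.card → F ∈ 𝓐 := fun F hF hc =>
    hcl.mem_of_card hA hAg hF (by omega)
  have h2 : ∀ F ∈ 𝓐, 2 ≤ F.card := fun F hF => by
    by_contra hlt
    by_cases hFB : (F ∩ B).Nonempty
    · have := card_pos.2 hFB
      exact hB𝓐 (hcl.mem_of_card hF (hsub F hF) hB (by omega))
    · exact hB𝓐 (hcl.mem_of_card hF (hsub F hF) hB (by omega))
  have hd : Disjoint (pairSupport 𝓐) B := disjoint_left.2 fun x hx hxB =>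
    hB𝓐 (hcl.mem_of_mem_pairSupport h𝓐 hB hB3 hxB hx)
  have hKg : pairSupport 𝓐 ⊆ groundSet n := fun x hx => by
    obtain ⟨A', hA', -, hxA'⟩ := mem_pairSupport.1 hx
    exact hsub A' hA' hxA'
  have hAK : A ⊆ pairSupport 𝓐 := fun x hx => mem_pairSupport.2 ⟨A, hA, hA2, hx⟩
  obtain ⟨b₁, b₂, b₃, h12, h13, h23, rfl⟩ := card_eq_three.1 hB3
  have hcfg := config_of_disjoint (by rwa [card_groundSet]) hB h12 h13 h23 hKg hAK hA2 hd
  obtain ⟨σ, hσA, hσ⟩ := exists_perm_image_eq (s := A) (t := {b₁, b₂})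
    (by rw [hA2, card_pair h12])
  have hbB : ({b₁, b₂} : Finset ℕ) ⊆ {b₁, b₂, b₃} := insert_subset_insert _ (by simp)
  have hbg := hbB.trans hB
  have hσg : ∀ x ∈ groundSet n, σ x ∈ groundSet n := fun x hx =>
    perm_mem_of_fix (fun y hy => hσ y (fun h => hy (hAg h)) (fun h => hy (hbg h))) hx
  obtain ⟨t, rfl⟩ : ∃ t, s = t + 1 := ⟨s - 1, by omega⟩
  obtain ⟨𝓗, hle, h𝓗, Q, hQg, hQB, hQ6, hQ𝓗⟩ := hcfg.exists_deficient t
  set B : Finset ℕ := {b₁, b₂, b₃}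
  have hne : ∀ F : Finset ℕ, 3 ≤ F.card → F ≠ A := by
    rintro F h3 rfl
    omega
  -- the members of `𝓐` meeting `A` are dominated by those meeting `B`
  have hle1 : (interFams t ((𝓐.erase A).filter fun F => (F ∩ A).Nonempty)).card ≤
      (interFams t 𝓗).card := by
    rw [← card_interFams_image_perm t σ]
    refine le_trans (card_interFams_mono fun F hF => ?_) hle
    obtain ⟨F, hF', rfl⟩ := mem_image.1 hF
    obtain ⟨hF1, hFA⟩ := mem_filter.1 hF'
    obtain ⟨hFne, hF𝓐⟩ := mem_erase.1 hF1
    refine image_mem_baseFam hσg hσA (hsub F hF𝓐) hFA ?_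
    by_cases hF3 : 3 ≤ F.card
    · exact Or.inl hF3
    · right
      have hF2 : F.card = 2 := by have := h2 F hF𝓐; omega
      obtain ⟨a, ha⟩ := hFA
      obtain ⟨haF, haA⟩ := mem_inter.1 ha
      obtain ⟨κ, hκF, hκa, rfl⟩ :=
        exists_eq_pair_of_mem (mem_layerEQ.2 ⟨hsub F hF𝓐, hF2⟩) haF
      have hκA : κ ∉ A := fun hκA => hFne
        (eq_of_subset_of_card_le (insert_subset haA (singleton_subset_iff.2 hκA)) (by omega))
      have hκK : κ ∈ pairSupport 𝓐 := mem_pairSupport.2 ⟨_, hF𝓐, hF2, by simp⟩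
      refine ⟨a, haA, κ, mem_sdiff.2 ⟨hκK, hκA⟩, hσ κ hκA fun hκ => ?_, rfl⟩
      exact disjoint_left.1 hd hκK (hbB hκ)
  have hsub𝓗 : 𝓗 ⊆ (𝓐.erase A).filter fun F => (F ∩ B).Nonempty := by
    intro F hF
    obtain ⟨hFg, hFB, hF4⟩ := h𝓗 F hF
    refine mem_filter.2 ⟨mem_erase.2 ⟨hne F (by omega), ?_⟩, hFB⟩
    rcases hF4 with hF4 | ⟨hF3, hFM⟩
    · exact h4 F hFg hF4
    · obtain ⟨x, hxF, hx⟩ := not_subset.1 hFM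
      rw [mem_union, not_or, mem_sdiff, mem_sdiff] at hx
      refine hcl.mem_of_mem_pairSupport h𝓐 hFg hF3 hxF ?_
      by_contra hxK
      exact hx.1 ⟨⟨hFg hxF, hx.2⟩, hxK⟩
  have hlt : (interFams t 𝓗).card <
      (interFams t ((𝓐.erase A).filter fun F => (F ∩ B).Nonempty)).card := by
    obtain ⟨𝓔, hc, hB𝓔, hQ𝓔, hmeet, hmem⟩ := exists_interFam_of_pair (by omega) hs1 hs2 hB hQg
      (by rwa [inter_comm])
    have hQne : Q ≠ B := fun e => by rw [e] at hQ6; omega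
    refine card_lt_card (Finset.ssubset_iff_subset_ne.2 ⟨fun 𝓕 h𝓕 => ?_, fun e => ?_⟩)
    · obtain ⟨a1, a2, a3⟩ := mem_interFams.1 h𝓕
      exact mem_interFams.2 ⟨a1.trans hsub𝓗, a2, a3⟩
    · have hin : 𝓔.erase B ∈ interFams t ((𝓐.erase A).filter fun F => (F ∩ B).Nonempty) := by
        refine mem_interFams.2 ⟨fun X hX => ?_, by rw [card_erase_of_mem hB𝓔, hc]; rfl,
          fun X hX Y hY => hmeet X (mem_of_mem_erase hX) Y (mem_of_mem_erase hY)⟩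
        obtain ⟨hXB, hX⟩ := mem_erase.1 hX
        obtain ⟨hXg, hX'⟩ := hmem X hX
        have hX4 : 4 ≤ X.card := by
          rcases hX' with h | h | h
          · have := card_lt_card (Finset.ssubset_iff_subset_ne.2 ⟨h, fun e => hXB e.symm⟩)
            omega
          · have := card_le_card h
            omega
          · omega
        exact mem_filter.2 ⟨mem_erase.2 ⟨hne X (by omega), h4 X hXg hX4⟩, hmeet X hX B hB𝓔⟩
      rw [← e] at hin
      exact hQ𝓗 ((mem_interFams.1 hin).1 (mem_erase.2 ⟨hQne, hQ𝓔⟩))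
  have hBC : B ∉ 𝓐.erase A := fun h => hB𝓐 (mem_of_mem_erase h)
  refine ⟨insert B (𝓐.erase A), ?_, ?_, ?_⟩
  · exact insert_subset (mem_powerset.2 hB) ((erase_subset _ _).trans h𝓐)
  · rw [card_insert_of_notMem hBC, card_erase_add_one hA]
  · rw [card_interFams_insert t hBC (card_pos.1 (by omega))]
    have := card_interFams_insert t (notMem_erase A 𝓐) (card_pos.1 (by omega))
    rw [insert_erase hA] at this
    omega

theorem card_layerGE (n r : ℕ) : (layerGE n r).card = ∑ k ∈ Icc r n, n.choose k := by
  rw [card_eq_sum_card_fiberwise (f := card) (t := Icc r n) fun F hF => ?_]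
  · refine sum_congr rfl fun k hk => ?_
    rw [← card_groundSet n, ← card_powersetCard, card_groundSet]
    congr 1
    ext F
    have := mem_Icc.1 hk
    rw [mem_filter, mem_layerGE, mem_powersetCard]
    constructor
    · exact fun h => ⟨h.1.1, h.2⟩
    · exact fun h => ⟨⟨h.1, by omega⟩, h.2⟩
  · obtain ⟨h1, h2⟩ := mem_layerGE.1 hF
    have := card_le_card h1
    rw [card_groundSet] at this
    exact mem_coe.2 (mem_Icc.2 ⟨h2, this⟩)

/-- The family of all sets of size at least three and all pairs through `1`. -/
def starFam (n : ℕ) : Finset (Finset ℕ) := layerGE n 3 ∪ starPairs n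

theorem starFam_subset (n : ℕ) : starFam n ⊆ allFams n := by
  refine union_subset (filter_subset _ _) fun A hA => ?_
  exact mem_powerset.2 (mem_layerEQ.1 (starPairs_subset n hA)).1

theorem card_starFam {n : ℕ} (hn : 1 ≤ n) :
    (starFam n).card = (∑ k ∈ Icc 3 n, n.choose k) + (n - 1) := by
  rw [starFam, card_union_of_disjoint (disjoint_layerGE_three (starPairs_subset n)), card_layerGE,
    card_starPairs hn]

/-- The images of `starFam n` under permutations of the ground set. -/
def IsStarImage (n : ℕ) (𝓐 : Finset (Finset ℕ)) : Prop :=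
  ∃ σ : Equiv.Perm ℕ, (∀ x ∈ groundSet n, σ x ∈ groundSet n) ∧
    𝓐 = (starFam n).image fun A => A.image σ

theorem IsStarImage.layerGE_subset {n : ℕ} {𝓐 : Finset (Finset ℕ)} (h : IsStarImage n 𝓐) :
    layerGE n 3 ⊆ 𝓐 := by
  obtain ⟨σ, hσ, rfl⟩ := h
  have e : (layerGE n 3).image (fun A => A.image σ) = layerGE n 3 := by
    refine eq_of_subset_of_card_le (fun F hF => ?_) ?_
    · obtain ⟨F, hF1, rfl⟩ := mem_image.1 hF
      obtain ⟨h1, h2⟩ := mem_layerGE.1 hF1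
      refine mem_layerGE.2 ⟨image_perm_subset hσ h1, ?_⟩
      rwa [card_image_of_injective _ σ.injective]
    · rw [card_image_of_injective _ (image_injective σ.injective)]
  rw [← e]
  exact image_subset_image subset_union_left

theorem IsStarImage.two_le_card {n : ℕ} {𝓐 : Finset (Finset ℕ)} (h : IsStarImage n 𝓐)
    {F : Finset ℕ} (hF : F ∈ 𝓐) : 2 ≤ F.card := by
  obtain ⟨σ, -, rfl⟩ := h
  obtain ⟨F, hF1, rfl⟩ := mem_image.1 hF
  rw [card_image_of_injective _ σ.injective]
  rcases mem_union.1 hF1 with h1 | h1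
  · have := (mem_layerGE.1 h1).2
    omega
  · exact (mem_layerEQ.1 (starPairs_subset n h1)).2.ge

theorem IsStarImage.mem_of_subset {n : ℕ} {𝓐 : Finset (Finset ℕ)} (h : IsStarImage n 𝓐)
    {S T : Finset ℕ} (hS : S ∈ 𝓐) (hT : T ⊆ groundSet n) (hST : S ⊆ T) : T ∈ 𝓐 := by
  by_cases h3 : 3 ≤ T.card
  · exact h.layerGE_subset (mem_layerGE.2 ⟨hT, h3⟩)
  · have := h.two_le_card hS
    rwa [← eq_of_subset_of_card_le hST (by omega)]

theorem IsStarImage.card_interFams {n : ℕ} {𝓐 : Finset (Finset ℕ)} (s : ℕ)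
    (h : IsStarImage n 𝓐) : (interFams s 𝓐).card = (interFams s (starFam n)).card := by
  obtain ⟨σ, -, rfl⟩ := h
  exact card_interFams_image_perm s σ _

/-- `𝓐` maximises the number of intersecting subfamilies of size `s` among families of its size. -/
def IsOptimal (n s : ℕ) (𝓐 : Finset (Finset ℕ)) : Prop :=
  ∀ 𝓐' ⊆ allFams n, 𝓐'.card = 𝓐.card → (interFams s 𝓐').card ≤ (interFams s 𝓐).card

theorem ExchangeClosed.two_le_card {n : ℕ} (hn : 1 ≤ n) {𝓐 : Finset (Finset ℕ)}
    (hcl : ExchangeClosed (groundSet n) 𝓐) (h𝓐 : 𝓐 ⊆ allFams n)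
    (hc : (𝓐 \ layerGE n 3).card = n - 1) {F : Finset ℕ} (hF : F ∈ 𝓐) : 2 ≤ F.card := by
  by_contra hlt
  have hFg := mem_powerset.1 (h𝓐 hF)
  obtain ⟨c, hc', hsing⟩ : ∃ c ∈ groundSet n, {c} ∈ 𝓐 := by
    rcases F.eq_empty_or_nonempty with rfl | ⟨c, hcF⟩
    · have h1 : 1 ∈ groundSet n := by simp [groundSet, hn]
      exact ⟨1, h1, hcl.mem_of_card hF hFg (singleton_subset_iff.2 h1) (by simp)⟩
    · have : F = {c} :=
        (eq_of_subset_of_card_le (singleton_subset_iff.2 hcF) (by simp; omega)).symm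
      exact ⟨c, hFg hcF, this ▸ hF⟩
  have hsub : insert {c} (((groundSet n).erase c).image fun x => ({c, x} : Finset ℕ)) ⊆
      𝓐 \ layerGE n 3 := by
    intro G hG
    rcases mem_insert.1 hG with rfl | hG
    · refine mem_sdiff.2 ⟨hsing, fun h => ?_⟩
      have := (mem_layerGE.1 h).2
      simp at this
    · obtain ⟨x, hx, rfl⟩ := mem_image.1 hG
      obtain ⟨hxc, hxg⟩ := mem_erase.1 hx
      have h2 : ({c, x} : Finset ℕ).card = 2 := card_pair hxc.symm
      refine mem_sdiff.2 ⟨hcl.mem_of_card hsing (singleton_subset_iff.2 hc')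
        (insert_subset hc' (singleton_subset_iff.2 hxg)) (by rw [h2, card_singleton]; omega),
        fun h => ?_⟩
      have := (mem_layerGE.1 h).2
      omega
  have hnot : ({c} : Finset ℕ) ∉ ((groundSet n).erase c).image fun x => ({c, x} : Finset ℕ) := by
    intro h
    obtain ⟨x, hx, e⟩ := mem_image.1 h
    have h2 := card_pair (mem_erase.1 hx).1.symm
    rw [e] at h2
    simp at h2
  have := card_le_card hsub
  rw [card_insert_of_notMem hnot, card_image_of_injOn (injOn_pair c _), card_erase_of_mem hc',
    card_groundSet] at this
  omega

theorem isStarImage_of_layerGE_subset {n s : ℕ} (hn : 5 ≤ n) (hs1 : 2 ≤ s) (hs2 : s ≤ 2 ^ (n - 1))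
    {𝓐 : Finset (Finset ℕ)} (h𝓐 : 𝓐 ⊆ allFams n)
    (hcard : 𝓐.card = (∑ k ∈ Icc 3 n, n.choose k) + (n - 1)) (hopt : IsOptimal n s 𝓐)
    (hcl : ExchangeClosed (groundSet n) 𝓐) (h3 : layerGE n 3 ⊆ 𝓐) : IsStarImage n 𝓐 := by
  have hGc : (𝓐 \ layerGE n 3).card = n - 1 := by
    rw [card_sdiff_of_subset h3, card_layerGE]
    omega
  have hG : 𝓐 \ layerGE n 3 ⊆ layerEQ n 2 := by
    intro F hF
    obtain ⟨hF𝓐, hF3⟩ := mem_sdiff.1 hF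
    have hFg := mem_powerset.1 (h𝓐 hF𝓐)
    have h2 := hcl.two_le_card (by omega) h𝓐 hGc hF𝓐
    refine mem_layerEQ.2 ⟨hFg, ?_⟩
    by_contra hne
    exact hF3 (mem_layerGE.2 ⟨hFg, by omega⟩)
  have e : layerGE n 3 ∪ (𝓐 \ layerGE n 3) = 𝓐 := union_sdiff_of_subset h3
  by_cases hc : ∃ c ∈ groundSet n, ∀ A ∈ 𝓐 \ layerGE n 3, c ∈ A
  · obtain ⟨c, hcg, hc⟩ := hc
    have h1g : 1 ∈ groundSet n := by simp [groundSet]; omega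
    have hσ : ∀ x ∈ groundSet n, Equiv.swap 1 c x ∈ groundSet n := by
      intro x hx
      rw [Equiv.swap_apply_def]
      split_ifs <;> assumption
    set P := (layerEQ n 2).filter fun A => c ∈ A with hP
    have hPc : P.card ≤ n - 1 := by
      obtain ⟨L, hL, hPL⟩ := eq_image_leaves (filter_subset (fun A => c ∈ A) (layerEQ n 2))
        fun A hA => (mem_filter.1 hA).2
      rw [hP, hPL]
      refine card_image_le.trans ((card_le_card hL).trans ?_)
      rw [card_erase_of_mem hcg, card_groundSet]
    have hbound : (layerGE n 3 ∪ P).card ≤ (∑ k ∈ Icc 3 n, n.choose k) + (n - 1) := by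
      rw [← card_layerGE]
      exact (card_union_le _ _).trans (Nat.add_le_add_left hPc _)
    have e1 : 𝓐 = layerGE n 3 ∪ P := by
      refine eq_of_subset_of_card_le ?_ (hbound.trans hcard.ge)
      rw [← e]
      exact union_subset_union_right fun A hA => mem_filter.2 ⟨hG hA, hc A hA⟩
    refine ⟨Equiv.swap 1 c, hσ, e1.trans (eq_of_subset_of_card_le ?_ ?_).symm⟩
    · intro F hF
      obtain ⟨F, hF1, rfl⟩ := mem_image.1 hF
      rcases mem_union.1 hF1 with hF | hF
      · obtain ⟨a1, a2⟩ := mem_layerGE.1 hF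
        refine mem_union_left _ (mem_layerGE.2 ⟨image_perm_subset hσ a1, ?_⟩)
        rwa [card_image_of_injective _ (Equiv.injective _)]
      · obtain ⟨a1, a2⟩ := mem_filter.1 hF
        obtain ⟨a3, a4⟩ := mem_layerEQ.1 a1
        refine mem_union_right _ (mem_filter.2 ⟨mem_layerEQ.2 ⟨image_perm_subset hσ a3, ?_⟩, ?_⟩)
        · rwa [card_image_of_injective _ (Equiv.injective _)]
        · exact mem_image.2 ⟨1, a2, Equiv.swap_apply_left 1 c⟩
    · rw [card_image_of_injective _ (image_injective (Equiv.injective _)),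
        card_starFam (by omega)]
      exact hbound
  · have hlt := card_interFams_lt_star hn hs1 hs2 hG hGc hc
    rw [e] at hlt
    exact absurd (hopt _ (starFam_subset n) (by rw [hcard, card_starFam (by omega)]))
      (not_le.2 hlt)

theorem layerGE_subset_of_isOptimal {n s : ℕ} (hn : 21 ≤ n) (hs1 : 2 ≤ s) (hs2 : s ≤ 2 ^ (n - 1))
    {𝓐 : Finset (Finset ℕ)} (h𝓐 : 𝓐 ⊆ allFams n)
    (hcard : 𝓐.card = (∑ k ∈ Icc 3 n, n.choose k) + (n - 1)) (hopt : IsOptimal n s 𝓐)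
    (hcl : ExchangeClosed (groundSet n) 𝓐) : layerGE n 3 ⊆ 𝓐 := by
  by_contra hno
  obtain ⟨B, hB, hB𝓐⟩ := not_subset.1 hno
  obtain ⟨hBg, hB3⟩ := mem_layerGE.1 hB
  obtain ⟨A, hA, hA3⟩ : ∃ A ∈ 𝓐, A ∉ layerGE n 3 := by
    by_contra! h
    have := card_le_card (show 𝓐 ⊆ layerGE n 3 from h)
    rw [card_layerGE] at this
    omega
  have hAg := mem_powerset.1 (h𝓐 hA)
  have hA2 : A.card ≤ 2 := by
    by_contra h
    exact hA3 (mem_layerGE.2 ⟨hAg, by omega⟩)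
  have hA2' : A.card = 2 := by
    by_contra h
    exact hB𝓐 (hcl.mem_of_card hA hAg hBg (by omega))
  have hB3' : B.card = 3 := by
    by_contra h
    exact hB𝓐 (hcl.mem_of_card hA hAg hBg (by omega))
  obtain ⟨𝓐', h1, h2, h3⟩ :=
    exists_improvement_of_missing_triple hn hs1 hs2 h𝓐 hcl hA hA2' hBg hB3' hB𝓐
  exact absurd (hopt 𝓐' h1 h2) (not_le.2 h3)

theorem compress_subset_allFams {n : ℕ} {U V : Finset ℕ} {𝓐 : Finset (Finset ℕ)}
    (h𝓐 : 𝓐 ⊆ allFams n) (hV : V ⊆ groundSet n) : compress U V 𝓐 ⊆ allFams n := by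
  intro F hF
  rcases mem_compress.1 hF with ⟨h1, -⟩ | ⟨K, hK, -, rfl⟩
  · exact h𝓐 h1
  · exact mem_powerset.2 (moveSet_subset (mem_powerset.1 (h𝓐 hK)) hV)

theorem IsOptimal.isStarImage {n s : ℕ} (hn : 21 ≤ n) (hs1 : 2 ≤ s) (hs2 : s ≤ 2 ^ (n - 1))
    {𝓐 : Finset (Finset ℕ)} (h𝓐 : 𝓐 ⊆ allFams n)
    (hcard : 𝓐.card = (∑ k ∈ Icc 3 n, n.choose k) + (n - 1)) (hopt : IsOptimal n s 𝓐) :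
    IsStarImage n 𝓐 := by
  classical
  by_contra hstar
  let bad := (allFams n).powerset.filter fun 𝓑 =>
    𝓑.card = 𝓐.card ∧ IsOptimal n s 𝓑 ∧ ¬ IsStarImage n 𝓑
  obtain ⟨𝓑, h𝓑, hmax⟩ := exists_max_image bad (fun 𝓑 => ∑ S ∈ 𝓑, S.card)
    ⟨𝓐, mem_filter.2 ⟨mem_powerset.2 h𝓐, rfl, hopt, hstar⟩⟩
  obtain ⟨h𝓑g, h𝓑c, h𝓑o, h𝓑s⟩ := mem_filter.1 h𝓑
  rw [mem_powerset] at h𝓑g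
  have h𝓑c' := h𝓑c.trans hcard
  by_cases hcl : ExchangeClosed (groundSet n) 𝓑
  · exact h𝓑s (isStarImage_of_layerGE_subset (by omega) hs1 hs2 h𝓑g h𝓑c' h𝓑o hcl
      (layerGE_subset_of_isOptimal hn hs1 hs2 h𝓑g h𝓑c' h𝓑o hcl))
  · unfold ExchangeClosed at hcl
    push Not at hcl
    obtain ⟨U, V, hU, hUV, -, hV, -, S, hS, hE, hm⟩ := hcl
    have hmov : Movable U V 𝓑 S := ⟨hE, hm⟩
    have hVne : V.Nonempty := card_pos.1 (by omega)
    have hle := card_interFams_le_compress (𝓐 := 𝓑) s hU hVne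
    have hcg := compress_subset_allFams (U := U) h𝓑g hV
    have hco : IsOptimal n s (compress U V 𝓑) := fun 𝓐' h1 h2 =>
      (h𝓑o 𝓐' h1 (h2.trans (card_compress U V 𝓑))).trans hle
    have hcs : IsStarImage n (compress U V 𝓑) := by
      by_contra hns
      have hin : compress U V 𝓑 ∈ bad := mem_filter.2 ⟨mem_powerset.2 hcg,
        (card_compress U V 𝓑).trans h𝓑c, hco, hns⟩
      exact absurd (hmax _ hin) (not_le.2 (sum_card_lt_sum_card_compress (by omega) hS hmov))
    have hSn : S ∉ compress U V 𝓑 := by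
      intro hSc
      rcases mem_compress.1 hSc with ⟨-, h1⟩ | ⟨K, -, -, h1⟩
      · exact h1 hmov
      · exact not_movable_of_subset hVne (h1 ▸ subset_moveSet K) hmov
    have hS2 : S.card ≤ 2 := by
      by_contra h
      exact hSn (hcs.layerGE_subset (mem_layerGE.2 ⟨mem_powerset.1 (h𝓑g hS), by omega⟩))
    have hlt := card_interFams_lt_compress_of_movable hn hs1 hs2 hU hUV hV h𝓑g hcs.layerGE_subset
      (fun S hS T hT hST => hcs.mem_of_subset hS hT hST) hS hS2 hmov
    exact absurd (h𝓑o _ hcg (card_compress U V 𝓑)) (not_le.2 hlt)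

theorem IsStarImage.isOptimal {n s : ℕ} (hn : 21 ≤ n) (hs1 : 2 ≤ s) (hs2 : s ≤ 2 ^ (n - 1))
    {𝓐 : Finset (Finset ℕ)} (h𝓐 : 𝓐 ⊆ allFams n)
    (hcard : 𝓐.card = (∑ k ∈ Icc 3 n, n.choose k) + (n - 1)) (h : IsStarImage n 𝓐) :
    IsOptimal n s 𝓐 := by
  obtain ⟨𝓑, h𝓑, hmax⟩ := exists_max_image ((allFams n).powersetCard 𝓐.card)
    (fun 𝓑 => (interFams s 𝓑).card) ⟨𝓐, mem_powersetCard.2 ⟨h𝓐, rfl⟩⟩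
  obtain ⟨h1, h2⟩ := mem_powersetCard.1 h𝓑
  have hopt : IsOptimal n s 𝓑 := fun 𝓐' h3 h4 =>
    hmax 𝓐' (mem_powersetCard.2 ⟨h3, h4.trans h2⟩)
  have hst := hopt.isStarImage hn hs1 hs2 h1 (h2.trans hcard)
  intro 𝓐' h3 h4
  rw [h.card_interFams s, ← hst.card_interFams s]
  exact hopt 𝓐' h3 (h4.trans h2.symm)

theorem stmt0 (n s : ℕ) (hn : 21 ≤ n) (hs1 : 2 ≤ s) (hs2 : s ≤ 2 ^ (n - 1))
    (𝓐 : Finset (Finset ℕ)) (h𝓐 : 𝓐 ⊆ allFams n)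
    (hcard : 𝓐.card = (∑ k ∈ Finset.Icc 3 n, n.choose k) + (n - 1)) :
    (∀ 𝓐' ⊆ allFams n, 𝓐'.card = 𝓐.card →
        (interFams s 𝓐').card ≤ (interFams s 𝓐).card) ↔
      ∃ σ : Equiv.Perm ℕ, (∀ x ∈ groundSet n, σ x ∈ groundSet n) ∧
        𝓐 = (layerGE n 3 ∪ (layerEQ n 2).filter fun A => 1 ∈ A).image
              fun A => A.image σ := by
  exact ⟨fun hopt => IsOptimal.isStarImage hn hs1 hs2 h𝓐 hcard hopt,
    fun h => IsStarImage.isOptimal hn hs1 hs2 h𝓐 hcard h⟩
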